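/- arXiv:1608.03482 — 3 statements merged into one kernel-verified Lean document; each statement's English description precedes it below -/
import Mathlib

section
/- Let 𝒞 be a pseudovariety of groups and let F₁ and F₂ each be a non-abelian free group (of arbitrary rank). If G ≤ F₁ × F₂ is a full subdirect product such that the quotient F₁/N₁ is not residually-𝒞, where N₁ := G ∩ F₁, then G is not 𝒞-conjugacy separable. -/
/-- A bundled group (in universe 0). -/
structure GrpB where
  carrier : Type
  str : Group carrier

attribute [instance] GrpB.str

/-- Bundle a group type. -/
def GrpB.of (G : Type) [h : Group G] : GrpB := ⟨G, h⟩

/-- `C` is a pseudovariety of groups: closed under isomorphism, subgroups,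
binary direct products and quotients. -/
def IsPseudovariety (C : GrpB → Prop) : Prop :=
  (∀ A B : GrpB, C A → Nonempty (B.carrier ≃* A.carrier) → C B) ∧
  (∀ (A : GrpB) (H : Subgroup A.carrier), C A → C (GrpB.of H)) ∧
  (∀ A B : GrpB, C A → C B → C (GrpB.of (A.carrier × B.carrier))) ∧
  (∀ (A : GrpB) (N : Subgroup A.carrier) [N.Normal], C A → C (GrpB.of (A.carrier ⧸ N)))

/-- `C` is extension-closed. -/
def IsExtensionClosed (C : GrpB → Prop) : Prop :=
  ∀ (A : GrpB) (N : Subgroup A.carrier) [N.Normal],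
    C (GrpB.of N) → C (GrpB.of (A.carrier ⧸ N)) → C A

/-- Every member of `C` is a finite group. -/
def ClassOfFiniteGroups (C : GrpB → Prop) : Prop := ∀ A : GrpB, C A → Finite A.carrier

/-- `C` contains at least one non-trivial group. -/
def ClassNontrivial (C : GrpB → Prop) : Prop := ∃ A : GrpB, C A ∧ ∃ a : A.carrier, a ≠ 1

/-- `P` is residually-`C`. -/
def ResiduallyC (C : GrpB → Prop) (P : Type) [Group P] : Prop :=
  ∀ p : P, p ≠ 1 → ∃ M : GrpB, C M ∧ ∃ φ : P →* M.carrier, φ p ≠ 1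

/-- `G` is `C`-conjugacy separable. -/
def ConjSepC (C : GrpB → Prop) (G : Type) [Group G] : Prop :=
  ∀ x y : G, ¬ IsConj x y → ∃ M : GrpB, C M ∧ ∃ φ : G →* M.carrier, ¬ IsConj (φ x) (φ y)

/-- `N` is a co-`C` (normal) subgroup of `F`. -/
def IsCoC (C : GrpB → Prop) {F : Type} [Group F] (N : Subgroup F) : Prop :=
  ∃ hn : N.Normal, letI := hn; C (GrpB.of (F ⧸ N))

/-- The pro-`C` topology on `F`: generated by the cosets of co-`C` subgroups. -/
def ProCTop (C : GrpB → Prop) (F : Type) [Group F] : TopologicalSpace F :=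
  TopologicalSpace.generateFrom
    {S : Set F | ∃ N : Subgroup F, IsCoC C N ∧ ∃ g : F, S = {x : F | g⁻¹ * x ∈ N}}

/-- `X` is closed in the pro-`C` topology on `F`. -/
def CClosed (C : GrpB → Prop) {F : Type} [Group F] (X : Set F) : Prop :=
  @IsClosed F (ProCTop C F) X

/-- `X` is open in the pro-`C` topology on `F`. -/
def COpen (C : GrpB → Prop) {F : Type} [Group F] (X : Set F) : Prop :=
  @IsOpen F (ProCTop C F) X

/-- Closure of `X` in the pro-`C` topology on `F`. -/
def CClosure (C : GrpB → Prop) {F : Type} [Group F] (X : Set F) : Set F :=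
  @closure F (ProCTop C F) X

/-- `F` is `C`-hereditarily conjugacy separable: every `C`-open subgroup is
`C`-conjugacy separable. -/
def HerConjSepC (C : GrpB → Prop) (F : Type) [Group F] : Prop :=
  ∀ H : Subgroup F, COpen C (H : Set F) → ConjSepC C H

/-- `M` is cyclic subgroup `C`-separable: every cyclic subgroup is `C`-closed. -/
def CyclicSubgroupSepC (C : GrpB → Prop) (M : Type) [Group M] : Prop :=
  ∀ m : M, CClosed C ((Subgroup.zpowers m : Subgroup M) : Set M)

/-- `M` is highly residually-`C`: every extension of a `C`-group by `M` is residually-`C`. -/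
def HighlyResiduallyC (C : GrpB → Prop) (M : Type) [Group M] : Prop :=
  ∀ (L : Type) [Group L], ∀ (K : Subgroup L) [K.Normal],
    C (GrpB.of K) → Nonempty ((L ⧸ K) ≃* M) → ResiduallyC C L

/-- `F` has cyclic centralizers. -/
def HasCyclicCentralizers (F : Type) [Group F] : Prop :=
  ∀ f : F, f ≠ 1 → IsCyclic (Subgroup.centralizer ({f} : Set F))

/-- `G ≤ F₁ × F₂` is a subdirect product. -/
def IsSubdirect {F₁ F₂ : Type} [Group F₁] [Group F₂] (G : Subgroup (F₁ × F₂)) : Prop :=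
  Subgroup.map (MonoidHom.fst F₁ F₂) G = ⊤ ∧ Subgroup.map (MonoidHom.snd F₁ F₂) G = ⊤

/-- `G ≤ F₁ × F₂` is a full subdirect product. -/
def IsFullSubdirect {F₁ F₂ : Type} [Group F₁] [Group F₂] (G : Subgroup (F₁ × F₂)) : Prop :=
  IsSubdirect G ∧ Subgroup.comap (MonoidHom.inl F₁ F₂) G ≠ ⊥ ∧
    Subgroup.comap (MonoidHom.inr F₁ F₂) G ≠ ⊥

/-- `F` is a free group (of arbitrary rank). -/
def IsFreeGroupType (F : Type) [Group F] : Prop := ∃ S : Type, Nonempty (F ≃* FreeGroup S)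

/-- `F` is a non-abelian free group. -/
def IsNonAbelianFree (F : Type) [Group F] : Prop :=
  IsFreeGroupType F ∧ ∃ a b : F, a * b ≠ b * a

/-- The class of finite `p`-groups. -/
def CP (p : ℕ) : GrpB → Prop := fun A => Finite A.carrier ∧ IsPGroup p A.carrier

/-- The class of all finite groups. -/
def CFin : GrpB → Prop := fun A => Finite A.carrier

/-- A `Q'`-group: every element has finite order coprime to every `q ∈ Q`. -/
def IsQPrimeGroup (Q : Set ℕ) (F : Type) [Group F] : Prop :=
  ∀ f : F, IsOfFinOrder f ∧ ∀ q ∈ Q, Nat.Coprime (orderOf f) q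

namespace FreeGroup

theorem eq_append_comm_of_flatten_replicate_append_eq {β : Type*} {w v r : List β} {k : ℕ}
    (hw : w ≠ []) (hk : 2 ≤ k)
    (h : (List.replicate (v.length + 2) w).flatten ++ v = (List.replicate k r).flatten) :
    w ++ r = r ++ w := by
  obtain ⟨k, rfl⟩ := Nat.exists_eq_add_of_le' hk
  have hw' : 1 ≤ w.length := List.length_pos_iff.2 hw
  have hl := congrArg List.length h
  simp only [List.length_append, List.length_flatten, List.map_replicate, List.sum_replicate, smul_eq_mul] at hl
  have h1 : r.length ≤ (v.length + 1) * w.length := by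
    nlinarith [Nat.zero_le (k * r.length), Nat.mul_le_mul_left v.length hw']
  have h2 : w.length ≤ (k + 1) * r.length := by
    nlinarith [Nat.zero_le (k * r.length), Nat.zero_le (v.length * w.length)]
  set W := (List.replicate (v.length + 1) w).flatten with hW
  set R := (List.replicate (k + 1) r).flatten with hR
  have eW : (List.replicate (v.length + 2) w).flatten = w ++ W := by
    rw [List.replicate_succ, List.flatten_cons]
  have eW' : (List.replicate (v.length + 2) w).flatten = W ++ w := by
    rw [List.replicate_succ', List.flatten_concat]
  have eR : (List.replicate (k + 2) r).flatten = r ++ R := by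
    rw [List.replicate_succ, List.flatten_cons]
  have eR' : (List.replicate (k + 2) r).flatten = R ++ r := by
    rw [List.replicate_succ', List.flatten_concat]
  have hWl : r.length ≤ W.length := by simpa [hW, List.length_flatten, List.map_replicate, List.sum_replicate, smul_eq_mul] using h1
  have hRl : w.length ≤ R.length := by simpa [hR, List.length_flatten, List.map_replicate, List.sum_replicate, smul_eq_mul] using h2
  have p1 : r <+: W := List.prefix_of_prefix_length_le (l₃ := W ++ w ++ v)
    ⟨R, by rw [← eW', h, eR]⟩ ⟨w ++ v, by simp⟩ hWl
  have p2 : w <+: R := List.prefix_of_prefix_length_le (l₃ := R ++ r)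
    ⟨W ++ v, by rw [← eR', ← h, eW, List.append_assoc]⟩ ⟨r, rfl⟩ hRl
  obtain ⟨s, hs⟩ := p1
  obtain ⟨s', hs'⟩ := p2
  have : (w ++ r) ++ (s ++ v) = (r ++ w) ++ s' := by
    rw [eW, eR, ← hs, ← hs'] at h
    simpa using h
  exact (List.append_inj this (by simp [add_comm])).1

variable {α : Type*}

theorem exists_toWord_pow_eq_of_isCyclicallyReduced [DecidableEq α] {t : FreeGroup α} {k : ℕ}
    (hk : k ≠ 0) (h : IsCyclicallyReduced (t ^ k).toWord) :
    ∃ r : List (α × Bool), mk r = t ∧ (t ^ k).toWord = (List.replicate k r).flatten := by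
  have e : (t ^ k).toWord = reduceCyclically.conjugator t.toWord ++
      (List.replicate k (reduceCyclically t.toWord)).flatten ++
        invRev (reduceCyclically.conjugator t.toWord) := by
    rw [toWord_pow, reduceCyclically.reduce_flatten_replicate isReduced_toWord, if_neg hk]
  have e1 := reduceCyclically.conj_conjugator_reduceCyclically t.toWord
  rcases hc : reduceCyclically.conjugator t.toWord with _ | ⟨x, c⟩
  · rw [hc] at e e1
    refine ⟨reduceCyclically t.toWord, ?_, by simpa using e⟩
    simp only [List.nil_append, invRev_empty, List.append_nil] at e1
    rw [e1, mk_toWord]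
  · rw [hc] at e
    rw [e] at h
    have := h.2 (x.1, !x.2) (by
      rw [Option.mem_def, List.getLast?_append_of_ne_nil _ (by simp [invRev])]
      simp [invRev]) x (by simp)
    simp at this

theorem pow_ne_mk_flatten_replicate_append {w v : List (α × Bool)}
    (hw : IsCyclicallyReduced w) (hw' : w ≠ []) (hwv : IsReduced (w ++ v))
    (hvw : IsReduced (v ++ w)) (hne : w ++ v ≠ v ++ w) (t : FreeGroup α) {k : ℕ} (hk : 2 ≤ k) :
    t ^ k ≠ mk ((List.replicate (v.length + 2) w).flatten ++ v) := by
  classical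
  intro h
  have hv : v ≠ [] := by rintro rfl; simp at hne
  set A := (List.replicate (v.length + 2) w).flatten ++ v with hA
  have hAred : IsReduced A := by
    have := IsReduced.append_flatten_replicate_append (L₁ := []) hw (by simpa using hwv)
      (n := v.length + 2) (by omega)
    simpa using this
  have hAcyc : IsCyclicallyReduced A := by
    refine ⟨hAred, fun a ha b hb => ?_⟩
    rw [hA, List.getLast?_append_of_ne_nil _ hv] at ha
    rw [hA, List.replicate_succ, List.flatten_cons, List.append_assoc,
      List.head?_append_of_ne_nil _ hw'] at hb
    exact (List.isChain_append.1 hvw).2.2 a ha b hb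
  have hword : (t ^ k).toWord = A := by rw [h, toWord_mk, hAred.reduce_eq]
  obtain ⟨r, hr, e⟩ := exists_toWord_pow_eq_of_isCyclicallyReduced (t := t) (k := k) (by omega)
    (hword ▸ hAcyc)
  have hcomm := eq_append_comm_of_flatten_replicate_append_eq hw' hk (hword.symm.trans e)
  have hwt : Commute (mk w) t := by
    rw [← hr, commute_iff_eq, mul_mk, mul_mk, hcomm]
  have hA' : mk A = mk w ^ (v.length + 2) * mk v := by rw [hA, ← mul_mk, pow_mk]
  have hv' : mk v = (mk w ^ (v.length + 2))⁻¹ * t ^ k := by rw [h, hA', inv_mul_cancel_left]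
  have hwv' : Commute (mk w) (mk v) := by
    rw [hv']
    exact (((Commute.refl _).pow_right _).inv_right).mul_right (hwt.pow_right _)
  rw [commute_iff_eq, mul_mk, mul_mk] at hwv'
  have := reduce.sound hwv'
  rw [hwv.reduce_eq, hvw.reduce_eq] at this
  exact hne this

theorem isCyclic_of_forall_mul_comm (G : Type*) [Group G] [IsFreeGroup G]
    (h : ∀ a b : G, a * b = b * a) : IsCyclic G := by
  classical
  let e := IsFreeGroup.toFreeGroup G
  have : Subsingleton (IsFreeGroup.Generators G) := by
    refine ⟨fun a b => ?_⟩
    have := congrArg (fun x => (e x).toWord) (h (IsFreeGroup.of a) (IsFreeGroup.of b))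
    by_contra hab
    have hab' : ¬ b = a := fun h => hab h.symm
    simp [e, IsFreeGroup.of, IsFreeGroup.toFreeGroup, toWord_mul, reduce.cons, hab, hab'] at this
  rcases isEmpty_or_nonempty (IsFreeGroup.Generators G) with he | he
  · exact isCyclic_of_injective e.toMonoidHom e.injective
  · have := Classical.inhabited_of_nonempty he
    have := Unique.mk' (IsFreeGroup.Generators G)
    exact isCyclic_of_injective e.toMonoidHom e.injective

theorem mem_zpowers_of_commute {a u : FreeGroup α}
    (ha : ∀ (t : FreeGroup α) (k : ℕ), 2 ≤ k → t ^ k ≠ a)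
    (h : Commute u a) : u ∈ Subgroup.zpowers a := by
  let H := Subgroup.closure {u, a}
  have hH : ∀ x y : H, x * y = y * x := by
    have : ∀ x ∈ ({u, a} : Set (FreeGroup α)), ∀ y ∈ ({u, a} : Set (FreeGroup α)),
        x * y = y * x := by
      have := h.eq
      rintro x (rfl | rfl) y (rfl | rfl) <;> simp [this]
    have := Subgroup.isMulCommutative_closure this
    exact mul_comm'
  have hcyc : IsCyclic H := isCyclic_of_forall_mul_comm H hH
  obtain ⟨⟨t, ht⟩, hg⟩ := hcyc.exists_generator
  have hu := hg ⟨u, Subgroup.subset_closure (by simp)⟩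
  have haH := hg ⟨a, Subgroup.subset_closure (by simp)⟩
  obtain ⟨i, hi⟩ := hu
  obtain ⟨j, hj⟩ := haH
  have hi : t ^ i = u := by simpa using congrArg Subtype.val hi
  have hj : t ^ j = a := by simpa using congrArg Subtype.val hj
  have key : j.natAbs = 1 := by
    have h0 : j.natAbs ≠ 0 := by
      intro h0
      rw [Int.natAbs_eq_zero.1 h0, zpow_zero] at hj
      exact ha 1 2 le_rfl (by simpa using hj)
    have h2 : ¬ 2 ≤ j.natAbs := by
      intro h2
      rcases Int.natAbs_eq j with e | e
      · exact ha t _ h2 (by rw [← hj, ← zpow_natCast, ← e])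
      · exact ha t⁻¹ _ h2 (by rw [← hj, ← zpow_natCast, inv_zpow', ← e])
    omega
  rcases Int.natAbs_eq_iff.1 key with rfl | rfl
  · exact ⟨i, by simpa [← hj] using hi⟩
  · exact ⟨-i, by simpa [← hj] using hi⟩

theorem exists_isCyclicallyReduced_mk_mem {N : Subgroup (FreeGroup α)} [hN : N.Normal]
    (h : N ≠ ⊥) : ∃ w : List (α × Bool), IsCyclicallyReduced w ∧ w ≠ [] ∧ mk w ∈ N := by
  classical
  obtain ⟨n, hn, hn1⟩ := N.bot_or_exists_ne_one.resolve_left h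
  have e := congrArg mk (reduceCyclically.conj_conjugator_reduceCyclically n.toWord)
  rw [mk_toWord, ← mul_mk, ← mul_mk, ← inv_mk] at e
  refine ⟨reduceCyclically n.toWord, reduceCyclically.isCyclicallyReduced isReduced_toWord,
    fun h0 => hn1 ?_, ?_⟩
  · rw [← e, h0, ← one_eq_mk, mul_one, mul_inv_cancel]
  · rw [← e] at hn
    have := hN.conj_mem _ hn (mk (reduceCyclically.conjugator n.toWord))⁻¹
    rwa [inv_inv, mul_assoc, inv_mul_cancel_right, inv_mul_cancel_left] at this

theorem exists_centralizer_le {N : Subgroup (FreeGroup α)} [hN : N.Normal]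
    (h : N ≠ ⊥) (hα : Nontrivial α) :
    ∃ a ∈ N, ∀ u, Commute u a → u ∈ N := by
  classical
  obtain ⟨w, hw, hw', hwN⟩ := exists_isCyclicallyReduced_mk_mem h
  suffices ∃ v : List (α × Bool), mk v ∈ N ∧ IsReduced (w ++ v) ∧ IsReduced (v ++ w) ∧
      w ++ v ≠ v ++ w by
    obtain ⟨v, hvN, hwv, hvw, hne⟩ := this
    have haN : mk ((List.replicate (v.length + 2) w).flatten ++ v) ∈ N := by
      rw [← mul_mk, ← pow_mk]
      exact mul_mem (pow_mem hwN _) hvN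
    refine ⟨_, haN, fun u hu => (Subgroup.zpowers_le.2 haN) (mem_zpowers_of_commute ?_ hu)⟩
    exact fun t k hk => pow_ne_mk_flatten_replicate_append hw hw' hwv hvw hne t hk
  have conj_mem (s : α × Bool) : mk ([s] ++ w ++ invRev [s]) ∈ N := by
    rw [← mul_mk, ← mul_mk, ← inv_mk]
    exact hN.conj_mem _ hwN _
  obtain ⟨x, hx⟩ : ∃ x, w.head? = some x := ⟨_, List.head?_eq_some_head hw'⟩
  obtain ⟨y, hy⟩ : ∃ y, w.getLast? = some y := ⟨_, List.getLast?_eq_some_getLast hw'⟩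
  have hred : List.IsChain (fun a b : α × Bool => a.1 = b.1 → a.2 = b.2) w := hw.isReduced
  by_cases hxy : x.1 = y.1
  · obtain ⟨s, hs⟩ := exists_ne x.1
    refine ⟨[(s, true)] ++ w ++ invRev [(s, true)], conj_mem _, ?_, ?_, ?_⟩
    · simp [IsReduced, List.isChain_append, List.isChain_cons, invRev, hx, hy, hred,
        ← hxy, hs, hs.symm]
    · simp [IsReduced, List.isChain_append, List.isChain_cons, invRev, hx, hy, hred,
        ← hxy, hs, hs.symm]
    · intro e
      have := congrArg List.head? e
      simp [hx] at this
      simp [this] at hs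
  · have hyx : ¬ y.1 = x.1 := fun h => hxy h.symm
    refine ⟨([x] ++ w ++ invRev [x]) ++ ([(y.1, !y.2)] ++ w ++ invRev [(y.1, !y.2)]),
      ?_, ?_, ?_, ?_⟩
    · rw [← mul_mk]
      exact mul_mem (conj_mem _) (conj_mem _)
    · simp [IsReduced, List.isChain_append, List.isChain_cons, invRev, hx, hy, hred, hxy, hyx]
    · simp [IsReduced, List.isChain_append, List.isChain_cons, invRev, hx, hy, hred, hxy, hyx]
    · intro e
      have e' : w ++ [x] = [x] ++ w := by
        refine (List.append_inj
          (t₁ := w ++ invRev [x] ++ ([(y.1, !y.2)] ++ w ++ invRev [(y.1, !y.2)]))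
          (t₂ := invRev [x] ++ ([(y.1, !y.2)] ++ w ++ invRev [(y.1, !y.2)]) ++ w) ?_ (by simp)).1
        simpa using e
      have := congrArg List.getLast? e'
      rw [List.getLast?_append_of_ne_nil _ hw', hy] at this
      simp only [List.getLast?_concat, Option.some.injEq] at this
      exact hxy (congrArg Prod.fst this)

end FreeGroup

theorem IsNonAbelianFree.exists_centralizer_le {F : Type} [Group F] (hF : IsNonAbelianFree F)
    (N : Subgroup F) [hN : N.Normal] (h : N ≠ ⊥) : ∃ a ∈ N, ∀ u, Commute u a → u ∈ N := by
  obtain ⟨⟨S, ⟨e⟩⟩, x, y, hxy⟩ := hF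
  have hS : Nontrivial S := by
    by_contra hS
    rw [not_nontrivial_iff_subsingleton] at hS
    have : IsCyclic (FreeGroup S) := by
      rcases isEmpty_or_nonempty S with _ | ⟨⟨s⟩⟩
      · infer_instance
      · have := uniqueOfSubsingleton s
        infer_instance
    have := IsCyclic.isMulCommutative (α := FreeGroup S)
    apply hxy
    apply e.injective
    rw [map_mul, map_mul]
    exact mul_comm' _ _
  have hM : (N.map e.toMonoidHom).Normal := hN.map _ e.surjective
  obtain ⟨_, ⟨a, ha, rfl⟩, hb⟩ := FreeGroup.exists_centralizer_le (N := N.map e.toMonoidHom)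
    (by rwa [Ne, Subgroup.map_eq_bot_iff_of_injective _ e.injective]) hS
  refine ⟨a, ha, fun u hu => ?_⟩
  obtain ⟨v, hv, hvu⟩ := hb (e u) (hu.map e)
  rwa [← e.injective hvu]

/-- If `p` dies in every `C`-quotient of `F₁ ⧸ N₁`, then every homomorphism from a subdirect
product `G` to a `C`-group sends each lift of `p` into the image of `N₁ × N₂`. -/
theorem IsPseudovariety.exists_map_eq_of_subdirect {C : GrpB → Prop} (hC : IsPseudovariety C)
    {F₁ F₂ : Type} [Group F₁] [Group F₂] {G : Subgroup (F₁ × F₂)} (hG : IsSubdirect G)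
    [hn : (G.comap (MonoidHom.inl F₁ F₂)).Normal] {p : F₁}
    (hp : ∀ M : GrpB, C M →
      ∀ φ : F₁ ⧸ G.comap (MonoidHom.inl F₁ F₂) →* M.carrier, φ (p : F₁) = 1)
    {M : GrpB} (hM : C M) (φ : G →* M.carrier) (g : G) (hg : (g : F₁ × F₂).1 = p) :
    ∃ n : G, ((n : F₁ × F₂).1, 1) ∈ G ∧ φ n = φ g := by
  let π : G →* F₁ := (MonoidHom.fst F₁ F₂).comp G.subtype
  have hπ : Function.Surjective π := by
    intro f
    have : f ∈ Subgroup.map (MonoidHom.fst F₁ F₂) G := hG.1 ▸ Subgroup.mem_top f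
    obtain ⟨g, hg, rfl⟩ := this
    exact ⟨⟨g, hg⟩, rfl⟩
  let K : Subgroup G := (G.comap (MonoidHom.inl F₁ F₂)).comap π
  let L : Subgroup φ.range := K.map φ.rangeRestrict
  have hL : L.Normal := Subgroup.Normal.map inferInstance _ φ.rangeRestrict_surjective
  let Ψ : G →* φ.range ⧸ L := (QuotientGroup.mk' L).comp φ.rangeRestrict
  have hΨ : ∀ k ∈ K, Ψ k = 1 := fun k hk =>
    (QuotientGroup.eq_one_iff _).2 (Subgroup.mem_map_of_mem _ hk)
  have hker : π.ker ≤ Ψ.ker := fun k hk => hΨ k (by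
    rw [Subgroup.mem_comap, MonoidHom.mem_ker.1 hk]
    exact one_mem _)
  let ψ : F₁ →* φ.range ⧸ L := π.liftOfSurjective hπ ⟨Ψ, hker⟩
  have hψ : ∀ k, ψ (π k) = Ψ k := π.liftOfRightInverse_comp_apply _ _ ⟨Ψ, hker⟩
  let θ : F₁ ⧸ G.comap (MonoidHom.inl F₁ F₂) →* φ.range ⧸ L := QuotientGroup.lift _ ψ (by
    intro f hf
    obtain ⟨k, rfl⟩ := hπ f
    rw [MonoidHom.mem_ker, hψ]
    exact hΨ k hf)
  obtain ⟨-, sub_mem, -, quot_mem⟩ := hC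
  have hCL : C (GrpB.of (φ.range ⧸ L)) :=
    @quot_mem (GrpB.of φ.range) L hL (sub_mem M φ.range hM)
  have h1 : Ψ g = 1 := by
    rw [← hψ g]
    have := hp _ hCL θ
    rw [← hg] at this
    exact this
  obtain ⟨n, hnK, hn⟩ := (QuotientGroup.eq_one_iff _).1 h1
  exact ⟨n, hnK, congrArg Subtype.val hn⟩

/-- Theorem 1.1, free case: if `G ≤ F₁ × F₂` is a full subdirect
product of non-abelian free groups and `F₁/N₁` is not residually-`C`, then `G` is
not `C`-conjugacy separable. -/
theorem stmt0 (C : GrpB → Prop) (hC : IsPseudovariety C)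
    (F₁ F₂ : Type) [Group F₁] [Group F₂]
    (hF₁ : IsNonAbelianFree F₁) (hF₂ : IsNonAbelianFree F₂)
    (G : Subgroup (F₁ × F₂)) (hG : IsFullSubdirect G)
    (N₁ : Subgroup F₁) (hN₁ : N₁ = Subgroup.comap (MonoidHom.inl F₁ F₂) G) [N₁.Normal]
    (hres : ¬ ResiduallyC C (F₁ ⧸ N₁)) :
    ¬ ConjSepC C ↥G := by
  subst hN₁
  obtain ⟨hsub, h₁, h₂⟩ := hG
  have hsnd : ∀ f : F₂, ∃ e : F₁, (e, f) ∈ G := by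
    intro f
    have : f ∈ Subgroup.map (MonoidHom.snd F₁ F₂) G := hsub.2 ▸ Subgroup.mem_top f
    obtain ⟨g, hg, rfl⟩ := this
    exact ⟨g.1, hg⟩
  have hN₂ : (G.comap (MonoidHom.inr F₁ F₂)).Normal := by
    refine ⟨fun n hn f => ?_⟩
    obtain ⟨e, he⟩ := hsnd f
    have := G.mul_mem (G.mul_mem he hn) (G.inv_mem he)
    simpa using this
  obtain ⟨a, ha, hca⟩ := hF₁.exists_centralizer_le _ h₁
  obtain ⟨b, hb, hcb⟩ := hF₂.exists_centralizer_le _ h₂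
  simp only [ResiduallyC, not_forall, not_exists, not_and, not_not, exists_prop] at hres
  obtain ⟨q, hq, hres⟩ := hres
  obtain ⟨p, rfl⟩ := QuotientGroup.mk_surjective q
  have hpN : p ∉ G.comap (MonoidHom.inl F₁ F₂) := fun h => hq ((QuotientGroup.eq_one_iff _).2 h)
  obtain ⟨⟨_, s⟩, hgG, rfl⟩ : p ∈ Subgroup.map (MonoidHom.fst F₁ F₂) G :=
    hsub.1 ▸ Subgroup.mem_top p
  rename_i p
  let g : G := ⟨(p, s), hgG⟩
  let α : G := ⟨(a, 1), ha⟩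
  let β : G := ⟨(1, b), hb⟩
  intro hsep
  obtain ⟨M, hM, φ, hφ⟩ := hsep (α * β) (g * α * g⁻¹ * β) (by
    intro hconj
    obtain ⟨⟨⟨u, v⟩, huv⟩, hc⟩ := isConj_iff.1 hconj
    have hc := congrArg Subtype.val hc
    simp only [g, α, β, Subgroup.coe_mul, Subgroup.coe_inv, Prod.mk_mul_mk, Prod.inv_mk,
      Prod.mk.injEq, mul_one, one_mul, mul_inv_cancel] at hc
    obtain ⟨hc1, hc2⟩ := hc
    have hv : (1, v) ∈ G := hcb v (mul_inv_eq_iff_eq_mul.1 hc2)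
    have hu : (u, 1) ∈ G := by simpa using G.mul_mem huv (G.inv_mem hv)
    have hpu : (p⁻¹ * u, (1 : F₂)) ∈ G := hca (p⁻¹ * u) (by
      have := congrArg (fun z => p⁻¹ * z * u) hc1
      simpa [Commute, SemiconjBy, mul_assoc] using this)
    have := G.mul_mem hu (G.inv_mem hpu)
    exact hpN (by simpa using this))
  obtain ⟨n, hn, hng⟩ := hC.exists_map_eq_of_subdirect hsub hres hM φ g rfl
  let m : G := ⟨((n : F₁ × F₂).1, 1), hn⟩
  have e1 : n * α * n⁻¹ = m * α * m⁻¹ := by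
    ext <;> simp [m, α]
  have e2 : m * β * m⁻¹ = β := by
    ext <;> simp [m, β]
  apply hφ
  rw [isConj_iff]
  refine ⟨φ m, ?_⟩
  calc φ m * φ (α * β) * (φ m)⁻¹ = φ ((m * α * m⁻¹) * (m * β * m⁻¹)) := by
        simp [mul_assoc]
    _ = φ (g * α * g⁻¹ * β) := by
        rw [← e1, e2]
        simp [hng]
end

section
/- Let 𝒞 be a non-trivial extension-closed pseudovariety of finite groups, let F₁ and F₂ be non-abelian free groups, and let G ≤ F₁ × F₂ be a subdirect product of finite index in F₁ × F₂. Then the following are equivalent: (1) G is 𝒞-conjugacy separable; (2) F₁/N₁ ∈ 𝒞, where N₁ := G ∩ F₁; (3) G is open in the pro-𝒞 topology on F₁ × F₂. -/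
theorem IsExtensionClosed.of_quotient {C : GrpB → Prop} (hCext : IsExtensionClosed C)
    {A : Type} [Group A] (N : Subgroup A) [hN : N.Normal] (h : C (GrpB.of N))
    (hquot : C (GrpB.of (A ⧸ N))) : C (GrpB.of A) :=
  @hCext (GrpB.of A) N hN h hquot

namespace IsPseudovariety

variable {C : GrpB → Prop}

theorem of_injective (hC : IsPseudovariety C) {A B : Type} [Group A] [Group B]
    (hB : C (GrpB.of B)) (f : A →* B) (hf : Function.Injective f) : C (GrpB.of A) :=
  hC.1 _ (GrpB.of A) (hC.2.1 (GrpB.of B) f.range hB) ⟨MonoidHom.ofInjective hf⟩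

theorem quotient (hC : IsPseudovariety C) {A : Type} [Group A] (hA : C (GrpB.of A))
    (N : Subgroup A) [hN : N.Normal] : C (GrpB.of (A ⧸ N)) :=
  have h := hC.2.2.2
  @h (GrpB.of A) N hN hA

theorem of_surjective (hC : IsPseudovariety C) {A B : Type} [Group A] [Group B]
    (hA : C (GrpB.of A)) (f : A →* B) (hf : Function.Surjective f) : C (GrpB.of B) :=
  hC.1 _ (GrpB.of B) (hC.quotient hA f.ker)
    ⟨(QuotientGroup.quotientKerEquivOfSurjective f hf).symm⟩

theorem of_ker_le (hC : IsPseudovariety C) {H X Y : Type} [Group H] [Group X] [Group Y]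
    (hY : C (GrpB.of Y)) (f : H →* X) (hf : Function.Surjective f) (g : H →* Y)
    (hfg : g.ker ≤ f.ker) : C (GrpB.of X) :=
  hC.of_surjective
    (hC.of_injective hY (QuotientGroup.kerLift g) (QuotientGroup.kerLift_injective g))
    (QuotientGroup.lift g.ker f hfg) (QuotientGroup.lift_surjective_of_surjective _ _ hf _)

theorem prod (hC : IsPseudovariety C) {A B : Type} [Group A] [Group B]
    (hA : C (GrpB.of A)) (hB : C (GrpB.of B)) : C (GrpB.of (A × B)) :=
  hC.2.2.1 _ _ hA hB

theorem of_subsingleton (hC : IsPseudovariety C) {A : Type} [Group A] (hA : C (GrpB.of A))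
    (B : Type) [Group B] [Subsingleton B] : C (GrpB.of B) :=
  hC.of_injective hA (1 : B →* A) (Function.injective_of_subsingleton _)

theorem pi (hC : IsPseudovariety C) (ι : Type) [Finite ι] {A : Type} [Group A]
    (hA : C (GrpB.of A)) : C (GrpB.of (ι → A)) := by
  induction ι using Finite.induction_empty_option with
  | @of_equiv α β e ih =>
    exact hC.of_injective ih (MonoidHom.mk' (fun f : β → A => fun a : α => f (e a))
      (fun _ _ => rfl)) fun f g h => by
        ext b; simpa using congrFun h (e.symm b)
  | h_empty => exact hC.of_subsingleton hA _
  | @h_option α _ ih =>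
    exact hC.of_injective (hC.prod hA ih) (MonoidHom.mk'
      (fun f : Option α → A => (f none, fun a => f (some a))) (fun _ _ => rfl)) fun f g h => by
        ext (_ | b)
        · exact congrArg Prod.fst h
        · exact congrFun (congrArg Prod.snd h) b

theorem of_extension (hC : IsPseudovariety C) (hCext : IsExtensionClosed C) {A B : Type}
    [Group A] [Group B] (f : A →* B) (hB : C (GrpB.of B)) (hker : C (GrpB.of f.ker)) :
    C (GrpB.of A) :=
  hCext.of_quotient f.ker hker
    (hC.of_injective hB (QuotientGroup.kerLift f) (QuotientGroup.kerLift_injective f))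

theorem exists_prime (hC : IsPseudovariety C) (hCfin : ClassOfFiniteGroups C)
    (hCnt : ClassNontrivial C) :
    ∃ p : ℕ, p.Prime ∧ C (GrpB.of (Multiplicative (ZMod p))) := by
  obtain ⟨A, hA, a, ha⟩ := hCnt
  have := hCfin A hA
  obtain ⟨p, hp, hdvd⟩ := Nat.exists_prime_and_dvd (mt orderOf_eq_one_iff.1 ha)
  refine ⟨p, hp, ?_⟩
  have hpos : 0 < orderOf a := orderOf_pos a
  have hord : orderOf (a ^ (orderOf a / p)) = p := orderOf_pow_orderOf_div hpos.ne' hdvd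
  have hcard : Nat.card (Subgroup.zpowers (a ^ (orderOf a / p))) = p := by
    rw [Nat.card_zpowers, hord]
  have e := zmodCyclicMulEquiv (G := Subgroup.zpowers (a ^ (orderOf a / p))) inferInstance
  rw [hcard] at e
  exact hC.1 _ _ (hC.2.1 A _ hA) ⟨e⟩

theorem of_isPGroup (hC : IsPseudovariety C) (hCext : IsExtensionClosed C) {p : ℕ}
    [Fact p.Prime] (hp : C (GrpB.of (Multiplicative (ZMod p)))) {P : Type} [Group P] [Finite P]
    (hP : IsPGroup p P) : C (GrpB.of P) := by
  induction hn : Nat.card P using Nat.strong_induction_on generalizing P with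
  | _ n ih =>
  rcases subsingleton_or_nontrivial P with hs | hs
  · exact hC.of_subsingleton hp P
  have hcenter : IsPGroup p (Subgroup.center P) := hP.to_subgroup _
  have : Nontrivial (Subgroup.center P) := hP.center_nontrivial
  have hdvd : p ∣ Nat.card (Subgroup.center P) := by
    obtain ⟨k, hk, hk'⟩ := (IsPGroup.nontrivial_iff_card hcenter).1 this
    rw [hk']
    exact dvd_pow_self p hk.ne'
  obtain ⟨z, hz⟩ := exists_prime_orderOf_dvd_card' p hdvd
  let Z : Subgroup P := Subgroup.zpowers (z : P)
  have hZc : Z ≤ Subgroup.center P := by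
    rw [Subgroup.zpowers_le]; exact z.2
  have hZn : Z.Normal := ⟨fun n hn g => by
    rwa [(Subgroup.mem_center_iff.1 (hZc hn) g), mul_inv_cancel_right]⟩
  have hcard : Nat.card Z = p := by
    rw [Nat.card_zpowers, Subgroup.orderOf_coe, hz]
  have hZ : C (GrpB.of Z) := by
    have e := zmodCyclicMulEquiv (G := Z) inferInstance
    rw [hcard] at e
    exact hC.1 _ _ hp ⟨e.symm⟩
  refine hCext.of_quotient Z hZ (ih _ ?_ (hP.to_quotient Z) rfl)
  rw [← hn, Z.card_eq_card_quotient_mul_card_subgroup, hcard]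
  exact lt_mul_of_one_lt_right Nat.card_pos (Fact.out : p.Prime).one_lt

end IsPseudovariety

section CoC

variable {C : GrpB → Prop}

theorem isCoC_ker (hC : IsPseudovariety C) {F M : Type} [Group F] [Group M]
    (hM : C (GrpB.of M)) (f : F →* M) : IsCoC C f.ker :=
  ⟨inferInstance, hC.of_injective hM (QuotientGroup.kerLift f) (QuotientGroup.kerLift_injective f)⟩

theorem IsCoC.inf (hC : IsPseudovariety C) {F : Type} [Group F] {N K : Subgroup F}
    (hN : IsCoC C N) (hK : IsCoC C K) : IsCoC C (N ⊓ K) := by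
  obtain ⟨_, hN⟩ := hN
  obtain ⟨_, hK⟩ := hK
  have := isCoC_ker hC (hC.prod hN hK) ((QuotientGroup.mk' N).prod (QuotientGroup.mk' K))
  rwa [MonoidHom.ker_prod, QuotientGroup.ker_mk', QuotientGroup.ker_mk'] at this

theorem IsCoC.mono (hC : IsPseudovariety C) {F : Type} [Group F] {N K : Subgroup F}
    (hN : IsCoC C N) (h : N ≤ K) [K.Normal] : IsCoC C K := by
  obtain ⟨_, hN⟩ := hN
  exact ⟨inferInstance, hC.of_ker_le hN (QuotientGroup.mk' K) (QuotientGroup.mk'_surjective K)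
    (QuotientGroup.mk' N) (by simpa using h)⟩

/-- A subgroup that is the kernel of a map from a co-`C` subgroup to a member of `C` contains
a co-`C` subgroup of the whole group. -/
theorem exists_isCoC_le (hC : IsPseudovariety C) (hCfin : ClassOfFiniteGroups C)
    (hCext : IsExtensionClosed C) {F : Type} [Group F] {N : Subgroup F} (hN : IsCoC C N)
    {M : Type} [Group M] (hM : C (GrpB.of M)) (f : N →* M) :
    ∃ K : Subgroup F, IsCoC C K ∧ K ≤ N ∧ ∀ n : N, (n : F) ∈ K → f n = 1 := by
  obtain ⟨hNn, hNC⟩ := hN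
  have : Finite (F ⧸ N) := hCfin _ hNC
  let K : Subgroup F := (f.ker.map N.subtype).normalCore
  have hKN : K ≤ N := (Subgroup.normalCore_le _).trans (Subgroup.map_subtype_le _)
  have hKf : ∀ n : N, (n : F) ∈ K → f n = 1 := by
    intro n hn
    obtain ⟨n', hn', h⟩ := Subgroup.normalCore_le _ hn
    rwa [Subtype.ext h] at hn'
  refine ⟨K, ⟨inferInstance, ?_⟩, hKN, hKf⟩
  let ψ : F ⧸ K →* F ⧸ N := QuotientGroup.map K N (MonoidHom.id F) hKN
  refine hC.of_extension hCext ψ hNC ?_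
  let g : N →* (F ⧸ N → M) := MonoidHom.mk'
    (fun n q => f ⟨q.out⁻¹ * n * q.out, hNn.conj_mem' n n.2 q.out⟩) (by
      intro a b
      funext q
      rw [Pi.mul_apply, ← map_mul]
      congr 1
      ext
      simp [mul_assoc])
  let ρ : N →* ψ.ker := ((QuotientGroup.mk' K).comp N.subtype).codRestrict _ (fun n => by
    rw [MonoidHom.mem_ker]
    exact (QuotientGroup.eq_one_iff _).2 n.2)
  refine hC.of_ker_le (hC.pi (F ⧸ N) hM) ρ ?_ g ?_
  · rintro ⟨q, hq⟩
    obtain ⟨a, rfl⟩ := QuotientGroup.mk_surjective q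
    exact ⟨⟨a, (QuotientGroup.eq_one_iff _).1 hq⟩, rfl⟩
  · intro n hn
    have hmem : (n : F) ∈ K := by
      intro b
      obtain ⟨m, hm⟩ : ∃ m : N, (QuotientGroup.mk b⁻¹ : F ⧸ N).out = b⁻¹ * m :=
        QuotientGroup.mk_out_eq_mul N b⁻¹
      have h1 := congrFun (MonoidHom.mem_ker.1 hn) (QuotientGroup.mk b⁻¹)
      have h2 : b * n * b⁻¹ ∈ N := hNn.conj_mem n n.2 b
      have h3 : f (m⁻¹ * ⟨b * n * b⁻¹, h2⟩ * m) = 1 := by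
        rw [← show _ = (1 : M) from h1]
        refine congrArg f (Subtype.ext ?_)
        change (m : F)⁻¹ * (b * n * b⁻¹) * m = (Quotient.out (QuotientGroup.mk b⁻¹ : F ⧸ N))⁻¹ * n *
          Quotient.out (QuotientGroup.mk b⁻¹ : F ⧸ N)
        rw [hm]
        simp [mul_assoc]
      rw [map_mul, map_mul, map_inv] at h3
      refine ⟨⟨_, h2⟩, ?_, rfl⟩
      change f _ = 1
      rwa [mul_eq_one_iff_eq_inv, mul_eq_left] at h3
    rw [MonoidHom.mem_ker]
    apply Subtype.ext
    exact (QuotientGroup.eq_one_iff _).2 hmem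

end CoC

section FoxCalculus

open Multiplicative
open FreeGroup (of mk mul_mk one_eq_mk)

variable {S P A : Type} [Group P] [AddCommGroup A]

/-- The action of `P` on functions `P → A` by right translation. -/
def rightTranslation (P A : Type) [Group P] [AddCommGroup A] :
    P →* MulAut (Multiplicative (P → A)) where
  toFun p :=
    { toFun := fun f => ofAdd fun h => f.toAdd (h * p)
      invFun := fun f => ofAdd fun h => f.toAdd (h * p⁻¹)
      left_inv := fun f => by simp
      right_inv := fun f => by simp
      map_mul' := fun _ _ => rfl }
  map_one' := by ext f; simp
  map_mul' p p' := by ext f; simp [mul_assoc]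

/-- The homomorphism from a free group to a wreath product that lifts `π` and has the
values `c` on generators as its base component. -/
def foxHom (π : FreeGroup S →* P) (c : P → S → A) :
    FreeGroup S →* Multiplicative (P → A) ⋊[rightTranslation P A] P :=
  FreeGroup.lift fun s => ⟨ofAdd fun h => c h s, π (of s)⟩

/-- The sum of the cochain `c` along the path in the Cayley graph of `P` that starts at `h`
and reads the word `u`. -/
def pathSum (π : FreeGroup S →* P) (c : P → S → A) (u : FreeGroup S) (h : P) : A :=
  (foxHom π c u).left.toAdd h

theorem foxHom_right (π : FreeGroup S →* P) (c : P → S → A) (u : FreeGroup S) :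
    (foxHom π c u).right = π u := by
  have : SemidirectProduct.rightHom.comp (foxHom π c) = π := by
    ext s; simp [foxHom]
  exact DFunLike.congr_fun this u

theorem pathSum_mul (π : FreeGroup S →* P) (c : P → S → A) (u v : FreeGroup S) (h : P) :
    pathSum π c (u * v) h = pathSum π c u h + pathSum π c v (h * π u) := by
  simp only [pathSum, map_mul, SemidirectProduct.mul_left, foxHom_right]
  rfl

theorem pathSum_of (π : FreeGroup S →* P) (c : P → S → A) (s : S) (h : P) :
    pathSum π c (of s) h = c h s := by
  simp [pathSum, foxHom]

theorem pathSum_one (π : FreeGroup S →* P) (c : P → S → A) (h : P) :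
    pathSum π c 1 h = 0 := by
  simp [pathSum]

theorem pathSum_inv (π : FreeGroup S →* P) (c : P → S → A) (u : FreeGroup S) (h : P) :
    pathSum π c u⁻¹ h = - pathSum π c u (h * (π u)⁻¹) := by
  have := pathSum_mul π c u⁻¹ u h
  rw [inv_mul_cancel, pathSum_one, map_inv] at this
  exact eq_neg_of_add_eq_zero_left this.symm

theorem pathSum_pow (π : FreeGroup S →* P) (c : P → S → A) (u : FreeGroup S) (m : ℕ) (h : P) :
    pathSum π c (u ^ m) h = ∑ i ∈ Finset.range m, pathSum π c u (h * π u ^ i) := by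
  induction m with
  | zero => simp [pathSum_one]
  | succ m ih => rw [pow_succ, pathSum_mul, ih, Finset.sum_range_succ, map_pow]

theorem eq_pathSum (π : FreeGroup S →* P) (D : FreeGroup S → P → A)
    (hD : ∀ u v h, D (u * v) h = D u h + D v (h * π u)) (u : FreeGroup S) (h : P) :
    D u h = pathSum π (fun h s => D (of s) h) u h := by
  have h1 : ∀ h, D 1 h = 0 := fun h => by simpa using hD 1 1 h
  induction u using FreeGroup.induction_on generalizing h with
  | C1 => rw [h1, pathSum_one]
  | of s => rw [pathSum_of]
  | inv_of s ih =>
    rw [pathSum_inv, ← ih]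
    have := hD (of s)⁻¹ (of s) h
    rw [inv_mul_cancel, h1, map_inv] at this
    exact eq_neg_of_add_eq_zero_left this.symm
  | mul u v hu hv => rw [hD, pathSum_mul, hu, hv]

theorem pathSum_zero (π : FreeGroup S →* P) (u : FreeGroup S) (h : P) :
    pathSum π (fun _ _ => (0 : A)) u h = 0 :=
  (eq_pathSum π (fun _ _ => (0 : A)) (by simp) u h).symm

theorem pathSum_mk_congr (π : FreeGroup S →* P) (c c' : P → S → A) (L : List (S × Bool)) (h : P)
    (hpos : ∀ L₁ s L₂, L = L₁ ++ (s, true) :: L₂ →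
      c (h * π (mk L₁)) s = c' (h * π (mk L₁)) s)
    (hneg : ∀ L₁ s L₂, L = L₁ ++ (s, false) :: L₂ →
      c (h * π (mk (L₁ ++ [(s, false)]))) s = c' (h * π (mk (L₁ ++ [(s, false)]))) s) :
    pathSum π c (mk L) h = pathSum π c' (mk L) h := by
  induction L generalizing h with
  | nil => rw [← one_eq_mk, pathSum_one, pathSum_one]
  | cons a L ih =>
    have hcons : mk (a :: L) = mk [a] * mk L := by rw [mul_mk]; rfl
    rw [hcons, pathSum_mul, pathSum_mul]
    congr 1
    · obtain ⟨s, e⟩ := a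
      cases e with
      | true =>
        have := hpos [] s L rfl
        rw [← one_eq_mk, map_one, mul_one] at this
        exact (pathSum_of π c s h).trans (this.trans (pathSum_of π c' s h).symm)
      | false =>
        have := hneg [] s L rfl
        have e : (mk [(s, false)] : FreeGroup S) = (of s)⁻¹ := rfl
        rw [List.nil_append, e, map_inv] at this
        rw [e, pathSum_inv, pathSum_inv, pathSum_of, pathSum_of, this]
    · apply ih
      · intro L₁ s L₂ hL
        have := hpos (a :: L₁) s L₂ (by rw [hL]; rfl)
        rwa [show mk (a :: L₁) = mk [a] * mk L₁ by rw [mul_mk]; rfl, map_mul, ← mul_assoc] at this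
      · intro L₁ s L₂ hL
        have := hneg (a :: L₁) s L₂ (by rw [hL]; rfl)
        rwa [show mk (a :: L₁ ++ [(s, false)]) = mk [a] * mk (L₁ ++ [(s, false)]) by
          rw [mul_mk]; rfl, map_mul, ← mul_assoc] at this

theorem pathSum_mk_congr_of_prefix (π : FreeGroup S →* P) (c c' : P → S → A)
    (L : List (S × Bool)) (h : P)
    (hc : ∀ L₁, L₁ <+: L → ∀ s, c (h * π (mk L₁)) s = c' (h * π (mk L₁)) s) :
    pathSum π c (mk L) h = pathSum π c' (mk L) h :=
  pathSum_mk_congr π c c' L h (fun L₁ s L₂ hL => hc L₁ ⟨_, hL.symm⟩ s)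
    (fun L₁ s L₂ hL => hc _ ⟨L₂, by simp [hL]⟩ s)

theorem pathSum_eq_of_foxHom_conj (π : FreeGroup S →* P) (c : P → S → A) {x y : FreeGroup S}
    {w : Multiplicative (P → A) ⋊[rightTranslation P A] P}
    (hw : SemiconjBy w (foxHom π c x) (foxHom π c y)) (hy : π y = 1) (h : P) :
    pathSum π c y h = pathSum π c x (h * w.right) := by
  have := congrArg (fun z => z.left.toAdd h) hw.eq
  simp only [SemidirectProduct.mul_left, foxHom_right, hy, map_one] at this
  change w.left.toAdd h + pathSum π c x (h * w.right) = pathSum π c y h + w.left.toAdd h at this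
  rw [add_comm] at this
  exact (add_right_cancel this).symm

theorem isPGroup_wreath {p : ℕ} [Fact p.Prime] [Finite P] (hP : IsPGroup p P) (r : ℕ) :
    Finite (Multiplicative (P → ZMod (p ^ r)) ⋊[rightTranslation P (ZMod (p ^ r))] P) ∧
    IsPGroup p (Multiplicative (P → ZMod (p ^ r)) ⋊[rightTranslation P (ZMod (p ^ r))] P) := by
  have : NeZero p := ⟨(Fact.out : p.Prime).ne_zero⟩
  refine ⟨Finite.of_equiv _ SemidirectProduct.equivProd.symm, ?_⟩
  obtain ⟨n, hn⟩ := IsPGroup.iff_card.1 hP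
  apply IsPGroup.of_card (n := r * Nat.card P + n)
  rw [SemidirectProduct.card, pow_add, ← hn]
  congr 1
  change Nat.card (P → ZMod (p ^ r)) = _
  rw [Nat.card_fun, Nat.card_zmod, pow_mul]

end FoxCalculus

section FreeGroupPSeparability

open FreeGroup (of mk mul_mk IsReduced toWord_eq_nil_iff mk_toWord isReduced_toWord)

theorem exists_common_pGroup_hom {F : Type} [Group F] (p : ℕ) {T : Set F} (hT : T.Finite)
    (h : ∀ u ∈ T, ∃ (P : Type) (_ : Group P) (_ : Finite P) (π : F →* P),
      IsPGroup p P ∧ π u ≠ 1) :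
    ∃ (P : Type) (_ : Group P) (_ : Finite P) (π : F →* P),
      IsPGroup p P ∧ ∀ u ∈ T, π u ≠ 1 := by
  induction T, hT using Set.Finite.induction_on with
  | empty => exact ⟨Unit, inferInstance, inferInstance, 1, fun g => ⟨0, rfl⟩, by simp⟩
  | @insert a T _ _ ih =>
    obtain ⟨P, _, _, π, hP, hπ⟩ := ih fun u hu => h u (Set.mem_insert_of_mem _ hu)
    obtain ⟨P', _, _, π', hP', hπ'⟩ := h a (Set.mem_insert _ _)
    refine ⟨P × P', inferInstance, inferInstance, π.prod π', ?_, ?_⟩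
    · rintro ⟨g, g'⟩
      obtain ⟨k, hk⟩ := hP g
      obtain ⟨k', hk'⟩ := hP' g'
      refine ⟨k + k', ?_⟩
      ext
      · simp [pow_add, pow_mul, hk]
      · simp [pow_add, mul_comm (p ^ k), pow_mul, hk']
    · rintro u (rfl | hu) h1
      · exact hπ' (congrArg Prod.snd h1)
      · exact hπ u hu (congrArg Prod.fst h1)

theorem exists_pGroup_hom_mk_ne_one {S : Type} (p : ℕ) [Fact p.Prime] (n : ℕ)
    (L : List (S × Bool)) (hn : L.length = n) (hL : IsReduced L) (hL0 : L ≠ []) :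
    ∃ (P : Type) (_ : Group P) (_ : Finite P) (π : FreeGroup S →* P),
      IsPGroup p P ∧ π (mk L) ≠ 1 := by
  classical
  induction n using Nat.strong_induction_on generalizing L with
  | _ n ih =>
  obtain ⟨P, _, _, π, hP, hπ⟩ := exists_common_pGroup_hom (F := FreeGroup S) p
    (T := mk '' {I | I ∈ {I | I ∈ L.sublists} ∧ I.length < n ∧ IsReduced I ∧ I ≠ []})
    (((List.finite_toSet _).subset fun I hI => hI.1).image _)
    (by rintro _ ⟨I, ⟨-, h1, h2, h3⟩, rfl⟩; exact ih _ h1 I rfl h2 h3)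
  have hsub : ∀ I, I <:+: L → I.length < L.length → π (mk I) = 1 → I = [] := by
    intro I hI hlt h1
    by_contra h0
    exact hπ _ ⟨I, ⟨List.mem_sublists.2 hI.sublist, hn ▸ hlt, hL.infix hI, h0⟩, rfl⟩ h1
  by_cases hLπ : π (mk L) = 1
  swap
  · exact ⟨P, _, inferInstance, π, hP, hLπ⟩
  obtain ⟨hfin, hW⟩ := isPGroup_wreath hP 1
  have : Fact (1 < p ^ 1) := ⟨by simpa using (Fact.out : p.Prime).one_lt⟩
  obtain ⟨L', ⟨s, e⟩, rfl⟩ : ∃ L' a, L = L' ++ [a] :=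
    ⟨L.dropLast, L.getLast hL0, (List.dropLast_append_getLast hL0).symm⟩
  let b : P := if e then π (mk L') else 1
  let c : P → S → ZMod (p ^ 1) := fun h t => if h = b ∧ t = s then 1 else 0
  have hsplit : ∀ L₁ L₂ : List (S × Bool), π (mk (L₁ ++ L₂)) = π (mk L₁) * π (mk L₂) := by
    intro L₁ L₂; rw [← map_mul, mul_mk]
  have hfirst : pathSum π c (mk L') 1 = 0 := by
    rw [← pathSum_zero π (mk L') 1]
    apply pathSum_mk_congr
    · rintro L₁ t L₂ rfl
      rw [one_mul]
      refine if_neg ?_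
      rintro ⟨hb, rfl⟩
      cases e with
      | true =>
        simp only [b, if_true] at hb
        rw [hsplit, left_eq_mul] at hb
        have := hsub ((t, true) :: L₂) ⟨L₁, [(t, true)], by simp⟩ (by simp; omega) hb
        simp at this
      | false =>
        simp only [b, Bool.false_eq_true, if_false] at hb
        have h1 := hsub L₁ ⟨[], (t, true) :: L₂ ++ [(t, false)], by simp⟩ (by simp) hb
        subst h1
        have h2 : π (mk L₂) = 1 := by
          have := hLπ
          rw [List.nil_append, List.cons_append, ← List.singleton_append (l := L₂ ++ _),
            hsplit, hsplit] at this
          have h3 : π (mk [(t, true)]) * π (mk [(t, false)]) = 1 := by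
            rw [← map_mul]; exact (congrArg π (mul_inv_cancel (of t))).trans (map_one π)
          rwa [eq_inv_of_mul_eq_one_right h3, ← mul_assoc, mul_inv_eq_one, mul_eq_left] at this
        have h3 := hsub L₂ ⟨[(t, true)], [(t, false)], by simp⟩ (by simp) h2
        subst h3
        simp at hL
    · rintro L₁ t L₂ rfl
      rw [one_mul]
      refine if_neg ?_
      rintro ⟨hb, rfl⟩
      cases e with
      | true =>
        simp only [b, if_true] at hb
        rw [← List.singleton_append (l := L₂), ← List.append_assoc, hsplit _ L₂, left_eq_mul] at hb
        have h3 := hsub L₂ ⟨L₁ ++ [(t, false)], [(t, true)], by simp⟩ (by simp; omega) hb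
        subst h3
        have := hL.infix (L₁ := [(t, false), (t, true)]) ⟨L₁, [], by simp⟩
        simp at this
      | false =>
        simp only [b, Bool.false_eq_true, if_false] at hb
        have := hsub (L₁ ++ [(t, false)]) ⟨[], L₂ ++ [(t, false)], by simp⟩ (by simp) hb
        simp at this
  have hlast : pathSum π c (mk [(s, e)]) (π (mk L')) ≠ 0 := by
    cases e with
    | true =>
      have : pathSum π c (mk [(s, true)]) (π (mk L')) = 1 :=
        (pathSum_of π c s _).trans (by simp [c, b])
      rw [this]; exact one_ne_zero
    | false =>
      have e1 : (mk [(s, false)] : FreeGroup S) = (of s)⁻¹ := rfl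
      rw [hsplit, e1, map_inv] at hLπ
      rw [e1, pathSum_inv, pathSum_of, hLπ]
      simp [c, b]
  refine ⟨_, inferInstance, hfin, foxHom π c, hW, fun h1 => hlast ?_⟩
  have h2 : pathSum π c (mk (L' ++ [(s, e)])) 1 = 0 := by simp [pathSum, h1]
  rwa [← mul_mk, pathSum_mul, hfirst, zero_add, one_mul] at h2

theorem exists_pGroup_hom_ne_one {S : Type} (p : ℕ) [Fact p.Prime]
    {u : FreeGroup S} (hu : u ≠ 1) :
    ∃ (P : Type) (_ : Group P) (_ : Finite P) (π : FreeGroup S →* P),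
      IsPGroup p P ∧ π u ≠ 1 := by
  classical
  have := exists_pGroup_hom_mk_ne_one p _ u.toWord rfl isReduced_toWord
    (mt toWord_eq_nil_iff.1 hu)
  rwa [mk_toWord] at this

end FreeGroupPSeparability

section Conj

open FreeGroup (of mk mul_mk IsReduced toWord_eq_nil_iff mk_toWord isReduced_toWord)

theorem IsFreeGroup.exists_hom_int_ne_one {K : Type} [Group K] [IsFreeGroup K] {x : K}
    (hx : x ∉ commutator K) : ∃ f : K →* Multiplicative ℤ, f x ≠ 1 := by
  let e := IsFreeGroup.toFreeGroup K
  have h0 : Abelianization.of (e x) ≠ 1 := by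
    rw [Ne, ← MonoidHom.mem_ker, Abelianization.ker_of]
    intro h
    apply hx
    have := Subgroup.map_commutator ⊤ ⊤ e.symm.toMonoidHom
    rw [Subgroup.map_top_of_surjective _ e.symm.surjective] at this
    rw [commutator_def, ← this]
    exact ⟨_, h, by simp⟩
  have h1 : FreeAbelianGroup.toFinsupp (Additive.ofMul (Abelianization.of (e x)) :
      FreeAbelianGroup (IsFreeGroup.Generators K)) ≠ 0 := by
    intro h
    exact h0 ((FreeAbelianGroup.equivFinsupp (IsFreeGroup.Generators K)).injective
      (h.trans (map_zero _).symm))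
  obtain ⟨i, hi⟩ := Finsupp.ne_iff.1 h1
  let g : Additive (Abelianization (FreeGroup (IsFreeGroup.Generators K))) →+ ℤ :=
    (Finsupp.applyAddHom i).comp FreeAbelianGroup.toFinsupp
  refine ⟨(AddMonoidHom.toMultiplicativeRight g).comp
    (Abelianization.of.comp e.toMonoidHom), ?_⟩
  intro h
  exact hi h

theorem exists_pGroup_hom_not_isConj_of_ne_one {S : Type} (p : ℕ) [Fact p.Prime]
    {x y : FreeGroup S} (hx : x ≠ 1) (hxy : ¬ IsConj x y) :
    ∃ (P : Type) (_ : Group P) (_ : Finite P) (π : FreeGroup S →* P),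
      IsPGroup p P ∧ ¬ IsConj (π x) (π y) := by
  classical
  let conjs : Set (FreeGroup S) := (fun I : List (S × Bool) × List (S × Bool) =>
    (mk I.2 * (mk I.1)⁻¹) * x * (mk I.2 * (mk I.1)⁻¹)⁻¹ * y⁻¹) ''
      ({I | I ∈ x.toWord.sublists} ×ˢ {I | I ∈ y.toWord.sublists})
  obtain ⟨Q, _, _, π₀, hQ, hπ₀⟩ := exists_common_pGroup_hom p (T := insert x conjs)
    ((((List.finite_toSet _).prod (List.finite_toSet _)).image _).insert _) (by
      rintro u (rfl | ⟨I, -, rfl⟩)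
      · exact exists_pGroup_hom_ne_one p hx
      · exact exists_pGroup_hom_ne_one p fun h =>
          hxy (isConj_iff.2 ⟨_, mul_inv_eq_one.1 h⟩))
  let P := π₀.range
  let π : FreeGroup S →* P := π₀.rangeRestrict
  have hP : IsPGroup p P := hQ.to_subgroup _
  have hπs : Function.Surjective π := π₀.rangeRestrict_surjective
  have hπ : ∀ u ∈ insert x conjs, π u ≠ 1 := fun u hu h => hπ₀ u hu (congrArg Subtype.val h)
  have hsep : ∀ X Y, X <+: x.toWord → Y <+: y.toWord →
      ∀ u, u = π (mk Y) * (π (mk X))⁻¹ → u * π x * u⁻¹ ≠ π y := by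
    rintro X Y hX hY _ rfl h
    refine hπ _ (Set.mem_insert_of_mem _ ⟨(X, Y), ⟨List.mem_sublists.2 hX.sublist,
      List.mem_sublists.2 hY.sublist⟩, rfl⟩) ?_
    rw [map_mul, map_mul, map_mul, map_inv, map_inv, map_mul, map_inv, h, mul_inv_cancel]
  let H : Subgroup (FreeGroup S) := (Subgroup.zpowers (π x)).comap π
  have hxH : x ∈ H := Subgroup.mem_zpowers _
  have hkerH : ∀ u, π u = 1 → u ∈ H := fun u hu => by
    change π u ∈ Subgroup.zpowers (π x); rw [hu]; exact one_mem _
  obtain ⟨f, hf⟩ : ∃ f : H →* Multiplicative ℤ, f ⟨x, hxH⟩ ≠ 1 := by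
    apply IsFreeGroup.exists_hom_int_ne_one
    intro hc
    let ρ : H →* Subgroup.zpowers (π x) := π.subgroupComap _
    let := IsCyclic.commGroup (α := Subgroup.zpowers (π x))
    have := Abelianization.commutator_subset_ker ρ hc
    exact hπ x (Set.mem_insert _ _) (congrArg Subtype.val (MonoidHom.mem_ker.1 this))
  let m := orderOf (π x)
  have hm : 0 < m := orderOf_pos _
  have hmx : π (x ^ m) = 1 := by rw [map_pow, pow_orderOf_eq_one]
  let k : ℤ := (f ⟨x, hxH⟩ ^ m).toAdd
  have hk : k ≠ 0 := by
    change (f ⟨x, hxH⟩ ^ m).toAdd ≠ 0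
    rw [toAdd_pow]
    exact smul_ne_zero hm.ne' hf
  obtain ⟨r, hr⟩ : ∃ r : ℕ, |k| < (p : ℤ) ^ r := by
    refine ⟨k.natAbs, ?_⟩
    have := Nat.lt_pow_self (n := k.natAbs) (Fact.out : p.Prime).one_lt
    zify at this
    exact this
  let τ : P → FreeGroup S := Function.surjInv hπs
  have hτ : ∀ h, π (τ h) = h := Function.surjInv_eq hπs
  have hD0 : ∀ u h, τ h * u * (τ (h * π u))⁻¹ ∈ H := fun u h => hkerH _ (by simp [hτ])
  let D : FreeGroup S → P → ZMod (p ^ r) := fun u h => ((f ⟨_, hD0 u h⟩).toAdd : ℤ)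
  have hD : ∀ u v h, D (u * v) h = D u h + D v (h * π u) := by
    intro u v h
    simp only [D]
    rw [← Int.cast_add, ← toAdd_mul, ← map_mul]
    congr 4
    simp [mul_assoc]
  have hDx : D (x ^ m) 1 ≠ 0 := by
    have : D (x ^ m) 1 = (k : ZMod (p ^ r)) := by
      simp only [D, k]
      congr 2
      rw [← map_pow]
      have h1 : τ 1 ∈ H := hkerH _ (hτ 1)
      have : (⟨_, hD0 (x ^ m) 1⟩ : H) = ⟨τ 1, h1⟩ * ⟨x, hxH⟩ ^ m * ⟨τ 1, h1⟩⁻¹ := by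
        ext; simp [hmx]
      rw [this, map_mul, map_mul, map_inv, mul_comm, inv_mul_cancel_left]
    rw [this, Ne, ZMod.intCast_zmod_eq_zero_iff_dvd]
    intro hdvd
    exact hk (Int.eq_zero_of_abs_lt_dvd hdvd (by push_cast; exact hr))
  let V : Set P := {v | ∃ (a : ℕ) (X : _), X <+: x.toWord ∧ v = π x ^ a * π (mk X)}
  let c : P → S → ZMod (p ^ r) := fun h s => D (of s) h
  let c' : P → S → ZMod (p ^ r) := fun h s => if h ∈ V then c h s else 0
  obtain ⟨hfin, hW⟩ := isPGroup_wreath hP r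
  refine ⟨_, inferInstance, hfin, foxHom π c', hW, ?_⟩
  intro hconj
  obtain ⟨w, hw⟩ := isConj_iff.1 hconj
  have hg : w.right * π x * w.right⁻¹ = π y := by
    have := congrArg SemidirectProduct.right hw
    simpa [foxHom_right] using this
  have hmy : π (y ^ m) = 1 := by
    rw [map_pow, ← hg, conj_pow, ← map_pow, hmx]; simp
  have hsemi : SemiconjBy w (foxHom π c' (x ^ m)) (foxHom π c' (y ^ m)) := by
    rw [map_pow, map_pow]
    exact (SemiconjBy.pow_right (mul_inv_eq_iff_eq_mul.1 hw) m)
  have hx' : pathSum π c' (x ^ m) 1 = D (x ^ m) 1 := by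
    rw [eq_pathSum π D hD, pathSum_pow, pathSum_pow]
    refine Finset.sum_congr rfl fun i _ => ?_
    rw [← mk_toWord (x := x)]
    refine pathSum_mk_congr_of_prefix _ _ _ _ _ fun X hX s => if_pos ⟨i, X, hX, ?_⟩
    rw [one_mul, mk_toWord]
  have hy' : pathSum π c' (y ^ m) w.right⁻¹ = 0 := by
    rw [pathSum_pow]
    refine Finset.sum_eq_zero fun i _ => ?_
    rw [← pathSum_zero π y (w.right⁻¹ * π y ^ i)]
    conv_lhs => rw [← mk_toWord (x := y)]
    conv_rhs => rw [← mk_toWord (x := y)]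
    refine pathSum_mk_congr_of_prefix _ _ _ _ _ fun Y hY s => if_neg ?_
    rw [mk_toWord]
    rintro ⟨a, X, hX, hv⟩
    refine hsep X Y hX hY _ rfl ?_
    have hu : π (mk Y) * (π (mk X))⁻¹ = (π y ^ i)⁻¹ * w.right * π x ^ a := by
      rw [mul_inv_eq_iff_eq_mul, mul_assoc _ (π x ^ a), ← hv]; group
    rw [hu]
    calc (π y ^ i)⁻¹ * w.right * π x ^ a * π x * ((π y ^ i)⁻¹ * w.right * π x ^ a)⁻¹
        = (π y ^ i)⁻¹ * (w.right * π x * w.right⁻¹) * π y ^ i := by group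
      _ = π y := by rw [hg]; group
  rw [pathSum_eq_of_foxHom_conj π c' hsemi hmy, inv_mul_cancel, hx'] at hy'
  exact hDx hy'

/-- Free groups are conjugacy separable with respect to finite `p`-groups. -/
theorem exists_pGroup_hom_not_isConj {S : Type} (p : ℕ) [Fact p.Prime]
    {x y : FreeGroup S} (hxy : ¬ IsConj x y) :
    ∃ (P : Type) (_ : Group P) (_ : Finite P) (π : FreeGroup S →* P),
      IsPGroup p P ∧ ¬ IsConj (π x) (π y) := by
  by_cases hx : x = 1
  · have hy : y ≠ 1 := by rintro rfl; exact hxy (hx ▸ IsConj.refl _)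
    obtain ⟨P, i, j, π, h, h'⟩ :=
      exists_pGroup_hom_not_isConj_of_ne_one p hy fun h => hxy h.symm
    exact ⟨P, i, j, π, h, fun h => h' h.symm⟩
  · exact exists_pGroup_hom_not_isConj_of_ne_one p hx hxy

end Conj

section ConjugacySeparability

variable {C : GrpB → Prop}

theorem IsCoC.iInf (hC : IsPseudovariety C) {F ι : Type} [Group F] [Finite ι]
    (htop : IsCoC C (⊤ : Subgroup F)) {K : ι → Subgroup F} (hK : ∀ i, IsCoC C (K i)) :
    IsCoC C (⨅ i, K i) := by
  have : Fintype ι := Fintype.ofFinite ι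
  rw [← Finset.inf_univ_eq_iInf]
  exact Finset.inf_induction htop (fun _ h _ h' => h.inf hC h') fun i _ => hK i

theorem conjSepC_of_mulEquiv {A B : Type} [Group A] [Group B] (e : A ≃* B)
    (h : ConjSepC C B) : ConjSepC C A := by
  intro x y hxy
  obtain ⟨M, hM, φ, hφ⟩ := h (e x) (e y) fun h => hxy (by
    simpa using e.symm.toMonoidHom.map_isConj h)
  exact ⟨M, hM, φ.comp e.toMonoidHom, hφ⟩

theorem conjSepC_of_isFreeGroup (hC : IsPseudovariety C) (hCfin : ClassOfFiniteGroups C)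
    (hCnt : ClassNontrivial C) (hCext : IsExtensionClosed C) (F : Type) [Group F]
    [IsFreeGroup F] : ConjSepC C F := by
  refine conjSepC_of_mulEquiv (IsFreeGroup.toFreeGroup F) fun x y hxy => ?_
  obtain ⟨p, hp, hCp⟩ := hC.exists_prime hCfin hCnt
  have : Fact p.Prime := ⟨hp⟩
  obtain ⟨P, _, _, π, hP, hπ⟩ := exists_pGroup_hom_not_isConj p hxy
  exact ⟨GrpB.of P, hC.of_isPGroup hCext hCp hP, π, hπ⟩

/-- Modulo a suitable co-`C` subgroup of a free group, an element which commutes with `a` is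
congruent modulo `N` to an element which really commutes with `a`. -/
theorem exists_isCoC_centralizer (hC : IsPseudovariety C) (hCfin : ClassOfFiniteGroups C)
    (hCnt : ClassNontrivial C) (hCext : IsExtensionClosed C) {F : Type} [Group F]
    [IsFreeGroup F] (a : F) {N : Subgroup F} (hN : IsCoC C N) :
    ∃ K : Subgroup F, IsCoC C K ∧ K ≤ N ∧
      ∀ c : F, c * a * c⁻¹ * a⁻¹ ∈ K → ∃ z : F, Commute z a ∧ z⁻¹ * c ∈ N := by
  have hN' := hN
  obtain ⟨hNn, hNC⟩ := hN'
  have : Finite (F ⧸ N) := hCfin _ hNC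
  suffices h : ∀ q : F ⧸ N, ∃ K : Subgroup F, IsCoC C K ∧ K ≤ N ∧
      ∀ c : F, (c : F ⧸ N) = q → c * a * c⁻¹ * a⁻¹ ∈ K →
        ∃ z : F, Commute z a ∧ z⁻¹ * c ∈ N by
    choose K hK hKN hKc using h
    exact ⟨⨅ q, K q, IsCoC.iInf hC (hN.mono hC le_top) hK, (iInf_le K 1).trans (hKN 1),
      fun c hc => hKc c c rfl (iInf_le K _ hc)⟩
  intro q
  let H : Subgroup F := (Subgroup.zpowers (a : F ⧸ N)).comap (QuotientGroup.mk' N)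
  have hNH : N ≤ H := fun n hn => by
    have : QuotientGroup.mk' N n = 1 := (QuotientGroup.eq_one_iff n).2 hn
    rw [Subgroup.mem_comap, this]
    exact one_mem _
  have haH : a ∈ H := Subgroup.mem_zpowers _
  by_cases hq : ∃ c : F, (c : F ⧸ N) = q ∧ c * a * c⁻¹ ∈ H ∧
      ¬ ∃ z : F, Commute z a ∧ z⁻¹ * c ∈ N
  · obtain ⟨b, rfl, hbH, hb⟩ := hq
    have hconj : ¬ IsConj (⟨b * a * b⁻¹, hbH⟩ : H) ⟨a, haH⟩ := by
      intro h
      obtain ⟨⟨h, hh⟩, hha⟩ := isConj_iff.1 h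
      have hha : h * (b * a * b⁻¹) * h⁻¹ = a := congrArg Subtype.val hha
      obtain ⟨k, hk⟩ := Subgroup.mem_zpowers_iff.1 (Subgroup.mem_comap.1 hh)
      have hcomm : Commute (h * b) a := by
        rw [commute_iff_eq]
        nth_rewrite 2 [← hha]
        group
      refine hb ⟨a ^ (-k) * (h * b), ((Commute.refl a).zpow_left _).mul_left hcomm, ?_⟩
      rw [← QuotientGroup.eq_one_iff]
      have hk : (h : F ⧸ N) = (a : F ⧸ N) ^ k := hk.symm
      simp [hk]
    obtain ⟨M, hM, f, hf⟩ := conjSepC_of_isFreeGroup hC hCfin hCnt hCext H _ _ hconj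
    obtain ⟨K, hK, hKN, hKf⟩ := exists_isCoC_le hC hCfin hCext hN hM
      (f.comp (Subgroup.inclusion hNH))
    refine ⟨K, hK, hKN, fun c hc hcK => (hf ?_).elim⟩
    have hn : c * b⁻¹ ∈ N := by
      rw [← QuotientGroup.eq_one_iff]
      simp [hc]
    refine isConj_iff.2 ⟨f ⟨c * b⁻¹, hNH hn⟩, ?_⟩
    have h1 := hKf ⟨_, hKN hcK⟩ hcK
    rw [← map_inv, ← map_mul, ← map_mul, ← mul_inv_eq_one, ← map_inv, ← map_mul, ← h1]
    refine congrArg f (Subtype.ext ?_)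
    change c * b⁻¹ * (b * a * b⁻¹) * (c * b⁻¹)⁻¹ * a⁻¹ = c * a * c⁻¹ * a⁻¹
    group
  · refine ⟨N, hN, le_rfl, fun c hc hcN => ?_⟩
    by_contra h
    refine hq ⟨c, hc, ?_, h⟩
    simpa using mul_mem (hNH hcN) haH

end ConjugacySeparability

section Centralizer

theorem isCyclic_of_isFreeGroup {H : Type} [Group H] [IsFreeGroup H]
    (h : ∀ a b : H, a * b = b * a) : IsCyclic H := by
  have hs : Subsingleton (IsFreeGroup.Generators H) := by
    refine ⟨fun s t => ?_⟩
    have h1 : FreeGroup.of s * FreeGroup.of t = FreeGroup.of t * FreeGroup.of s :=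
      (IsFreeGroup.toFreeGroup H).symm.injective (by simp only [map_mul]; exact h _ _)
    classical
    by_contra hst
    have h2 := congrArg (FreeGroup.lift fun u =>
      if u = s then Equiv.swap (0 : Fin 3) 1 else Equiv.swap 1 2) h1
    simp only [map_mul, FreeGroup.lift_apply_of, if_pos, if_neg (Ne.symm hst)] at h2
    exact absurd h2 (by decide)
  have : IsCyclic (FreeGroup (IsFreeGroup.Generators H)) := by
    rcases isEmpty_or_nonempty (IsFreeGroup.Generators H) with he | he
    · infer_instance
    · have := Classical.inhabited_of_nonempty he
      have := Unique.mk' (IsFreeGroup.Generators H)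
      infer_instance
  exact isCyclic_of_surjective (IsFreeGroup.toFreeGroup H).symm
    (IsFreeGroup.toFreeGroup H).symm.surjective

theorem exists_eq_zpow_of_commute {F : Type} [Group F] [IsFreeGroup F] {a b : F}
    (h : Commute a b) : ∃ (w : F) (i j : ℤ), a = w ^ i ∧ b = w ^ j := by
  let H : Subgroup F := Subgroup.closure {a, b}
  have hcomm : ∀ x y : H, x * y = y * x := by
    have := Subgroup.isMulCommutative_closure (k := {a, b}) (by
      rintro x (rfl | rfl) y (rfl | rfl)
      exacts [rfl, h.eq, h.eq.symm, rfl])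
    exact fun x y => mul_comm' x y
  have := isCyclic_of_isFreeGroup hcomm
  obtain ⟨w, hw⟩ := IsCyclic.exists_generator (α := H)
  obtain ⟨i, hi⟩ := Subgroup.mem_zpowers_iff.1 (hw ⟨a, Subgroup.subset_closure (by simp)⟩)
  obtain ⟨j, hj⟩ := Subgroup.mem_zpowers_iff.1 (hw ⟨b, Subgroup.subset_closure (by simp)⟩)
  exact ⟨w, i, j, (congrArg Subtype.val hi).symm, (congrArg Subtype.val hj).symm⟩

open Matrix Polynomial

theorem sl_mul_apply {R : Type} [CommRing R] (A B : SpecialLinearGroup (Fin 2) R) (i j : Fin 2) :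
    (A * B) i j = A i 0 * B 0 j + A i 1 * B 1 j := by
  change (A.1 * B.1) i j = _
  rw [mul_apply, Fin.sum_univ_two]

/-- The trace of a two by two matrix of determinant one. -/
def slTrace {R : Type} [CommRing R] (A : SpecialLinearGroup (Fin 2) R) : R := A 0 0 + A 1 1

theorem slTrace_one {R : Type} [CommRing R] : slTrace (1 : SpecialLinearGroup (Fin 2) R) = 2 := by
  change (1 : Matrix (Fin 2) (Fin 2) R) 0 0 + (1 : Matrix (Fin 2) (Fin 2) R) 1 1 = 2
  rw [one_apply_eq, one_apply_eq, one_add_one_eq_two]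

theorem slTrace_inv {R : Type} [CommRing R] (A : SpecialLinearGroup (Fin 2) R) :
    slTrace A⁻¹ = slTrace A := by
  simp [slTrace, SpecialLinearGroup.SL2_inv_expl, add_comm]

theorem slTrace_mul_mul {R : Type} [CommRing R] (A B : SpecialLinearGroup (Fin 2) R) :
    slTrace (A * (A * B)) = slTrace A * slTrace (A * B) - slTrace B := by
  have hdet := A.det_coe
  rw [det_fin_two] at hdet
  simp only [slTrace, sl_mul_apply]
  linear_combination (-(B 0 0) - B 1 1) * hdet

theorem slTrace_pow_add_two {R : Type} [CommRing R] (A : SpecialLinearGroup (Fin 2) R) (k : ℕ) :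
    slTrace (A ^ (k + 2)) = slTrace A * slTrace (A ^ (k + 1)) - slTrace (A ^ k) := by
  rw [pow_succ', pow_succ', slTrace_mul_mul]

theorem slTrace_zpow {R : Type} [CommRing R] (A : SpecialLinearGroup (Fin 2) R) (k : ℤ) :
    slTrace (A ^ k) = slTrace (A ^ k.natAbs) := by
  rcases Int.eq_nat_or_neg k with ⟨n, rfl | rfl⟩
  · simp
  · simp [slTrace_inv]

theorem natDegree_slTrace_pow (A : SpecialLinearGroup (Fin 2) ℤ[X]) (k : ℕ) :
    (slTrace (A ^ k)).natDegree = k * (slTrace A).natDegree := by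
  induction k using Nat.strong_induction_on with
  | _ k ih =>
  match k with
  | 0 => simp [slTrace_one]
  | 1 => simp
  | k + 2 =>
    rw [slTrace_pow_add_two]
    have h0 := ih k (by omega)
    have h1 := ih (k + 1) (by omega)
    rcases Nat.eq_zero_or_pos (slTrace A).natDegree with hd | hd
    · rw [hd, mul_zero] at h0 h1 ⊢
      exact Nat.le_zero.1 ((natDegree_sub_le _ _).trans
        (max_le (natDegree_mul_le.trans (by omega)) h0.le))
    · have hmul : (slTrace A * slTrace (A ^ (k + 1))).natDegree =
          (k + 2) * (slTrace A).natDegree := by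
        rw [natDegree_mul, h1]
        · ring
        · rintro h; simp [h] at hd
        · rintro h
          rw [h, natDegree_zero] at h1
          exact (Nat.mul_pos k.succ_pos hd).ne h1
      rw [natDegree_sub_eq_left_of_natDegree_lt, hmul]
      rw [hmul, h0]
      exact Nat.mul_lt_mul_of_pos_right (by omega) hd

/-- The elementary upper unitriangular matrix. -/
def upperUnitriangular {R : Type} [CommRing R] (x : R) : SpecialLinearGroup (Fin 2) R :=
  ⟨!![1, x; 0, 1], by simp [det_fin_two]⟩

/-- The elementary lower unitriangular matrix. -/
def lowerUnitriangular {R : Type} [CommRing R] (x : R) : SpecialLinearGroup (Fin 2) R :=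
  ⟨!![1, 0; x, 1], by simp [det_fin_two]⟩

theorem upperUnitriangular_pow {R : Type} [CommRing R] (x : R) (m : ℕ) :
    upperUnitriangular x ^ m = upperUnitriangular (m * x) := by
  have hmul (y : R) : upperUnitriangular y * upperUnitriangular x =
      upperUnitriangular (y + x) := by
    refine Subtype.ext ((mul_fin_two _ _ _ _ _ _ _ _).trans ?_)
    simp [upperUnitriangular, add_comm]
  induction m with
  | zero => rw [pow_zero, Nat.cast_zero, zero_mul]; exact Subtype.ext one_fin_two
  | succ m ih => rw [pow_succ, ih, hmul, Nat.cast_succ, add_one_mul]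

theorem lowerUnitriangular_pow {R : Type} [CommRing R] (x : R) (m : ℕ) :
    lowerUnitriangular x ^ m = lowerUnitriangular (m * x) := by
  have hmul (y : R) : lowerUnitriangular y * lowerUnitriangular x =
      lowerUnitriangular (y + x) := by
    refine Subtype.ext ((mul_fin_two _ _ _ _ _ _ _ _).trans ?_)
    simp [lowerUnitriangular, add_comm]
  induction m with
  | zero => rw [pow_zero, Nat.cast_zero, zero_mul]; exact Subtype.ext one_fin_two
  | succ m ih => rw [pow_succ, ih, hmul, Nat.cast_succ, add_one_mul]

theorem natAbs_eq_one_of_pow_mul_pow_eq_zpow {S : Type} {s t : S} (hst : s ≠ t) {m : ℕ}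
    (hm : m ≠ 0) {w : FreeGroup S} {k : ℤ}
    (h : FreeGroup.of s ^ m * FreeGroup.of t ^ m = w ^ k) : k.natAbs = 1 := by
  classical
  let ρ : FreeGroup S →* SpecialLinearGroup (Fin 2) ℤ[X] := FreeGroup.lift fun u =>
    if u = s then upperUnitriangular X else if u = t then lowerUnitriangular 1 else 1
  have hs : ρ (FreeGroup.of s) = upperUnitriangular X := by simp [ρ]
  have ht : ρ (FreeGroup.of t) = lowerUnitriangular 1 := by simp [ρ, hst.symm]
  have h1 := congrArg ρ h
  rw [map_mul, map_pow, map_pow, map_zpow, hs, ht, upperUnitriangular_pow,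
    lowerUnitriangular_pow] at h1
  have h2 := congrArg (fun A => (slTrace A).natDegree) h1
  rw [slTrace_zpow, natDegree_slTrace_pow] at h2
  have h3 : slTrace (upperUnitriangular ((m : ℤ[X]) * X) * lowerUnitriangular ((m : ℤ[X]) * 1)) =
      C ((m : ℤ) ^ 2) * X + C 2 := by
    rw [slTrace, sl_mul_apply, sl_mul_apply]
    simp [upperUnitriangular, lowerUnitriangular]
    ring
  have h4 : (C ((m : ℤ) ^ 2) * X + C 2 : ℤ[X]).natDegree = 1 :=
    natDegree_linear (by positivity)
  rw [h3, h4] at h2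
  exact Nat.eq_one_of_mul_eq_one_right h2.symm

theorem IsNonAbelianFree.isFreeGroup {F : Type} [Group F] (hF : IsNonAbelianFree F) :
    IsFreeGroup F := by
  obtain ⟨⟨S, ⟨e⟩⟩, -⟩ := hF
  exact IsFreeGroup.ofMulEquiv e.symm

/-- A normal subgroup of finite index in a non-abelian free group contains an element whose
centralizer is contained in the subgroup. -/
theorem exists_mem_forall_commute_mem {F : Type} [Group F] (hF : IsNonAbelianFree F)
    (N : Subgroup F) [N.Normal] (hN : N.index ≠ 0) :
    ∃ n ∈ N, ∀ c : F, Commute c n → c ∈ N := by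
  have := hF.isFreeGroup
  obtain ⟨⟨S, ⟨e⟩⟩, a, b, hab⟩ := hF
  obtain ⟨s, t, hst⟩ : ∃ s t : S, s ≠ t := by
    by_contra! h
    have : Subsingleton S := ⟨h⟩
    have : IsCyclic (FreeGroup S) := by
      rcases isEmpty_or_nonempty S with he | he
      · infer_instance
      · have := Classical.inhabited_of_nonempty he
        have := Unique.mk' S
        infer_instance
    let _ := IsCyclic.commGroup (α := FreeGroup S)
    exact hab (e.injective (by rw [map_mul, map_mul]; exact mul_comm _ _))
  let n : F := e.symm (FreeGroup.of s) ^ N.index * e.symm (FreeGroup.of t) ^ N.index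
  have hn : n ∈ N := mul_mem (Subgroup.pow_index_mem N _) (Subgroup.pow_index_mem N _)
  refine ⟨n, hn, fun c hc => ?_⟩
  obtain ⟨w, i, j, rfl, hj⟩ := exists_eq_zpow_of_commute hc
  have h := natAbs_eq_one_of_pow_mul_pow_eq_zpow hst hN (w := e w) (k := j) (by
    rw [← map_zpow, ← hj]; simp [n])
  have hw : w ∈ N := by
    rcases Int.natAbs_eq_iff.1 h with rfl | rfl
    · simpa [hj] using hn
    · simpa [hj] using hn
  exact zpow_mem hw i

end Centralizer

section Topology

variable {C : GrpB → Prop}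

theorem IsCoC.comap (hC : IsPseudovariety C) {A B : Type} [Group A] [Group B] (f : A →* B)
    {K : Subgroup B} (hK : IsCoC C K) : IsCoC C (K.comap f) := by
  obtain ⟨_, hK⟩ := hK
  have := isCoC_ker hC hK ((QuotientGroup.mk' K).comp f)
  rwa [← MonoidHom.comap_ker, QuotientGroup.ker_mk'] at this

theorem IsCoC.top (hC : IsPseudovariety C) (hCnt : ClassNontrivial C) (F : Type) [Group F] :
    IsCoC C (⊤ : Subgroup F) := by
  obtain ⟨A, hA, -⟩ := hCnt
  have := QuotientGroup.subsingleton_quotient_top (G := F)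
  exact ⟨inferInstance, hC.of_subsingleton (A := A.carrier) hA _⟩

theorem COpen.exists_isCoC (hC : IsPseudovariety C) (hCnt : ClassNontrivial C) {F : Type}
    [Group F] {U : Set F} (hU : COpen C U) {x : F} (hx : x ∈ U) :
    ∃ K : Subgroup F, IsCoC C K ∧ ∀ y : F, x⁻¹ * y ∈ K → y ∈ U := by
  induction hU with
  | basic U hU =>
    obtain ⟨N, hN, g, rfl⟩ := hU
    refine ⟨N, hN, fun y hy => ?_⟩
    simpa [mul_assoc] using mul_mem (show g⁻¹ * x ∈ N from hx) hy
  | univ => exact ⟨⊤, IsCoC.top hC hCnt F, fun _ _ => trivial⟩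
  | inter U V _ _ ihU ihV =>
    obtain ⟨K, hK, hKU⟩ := ihU hx.1
    obtain ⟨L, hL, hLV⟩ := ihV hx.2
    exact ⟨K ⊓ L, hK.inf hC hL, fun y hy => ⟨hKU y hy.1, hLV y hy.2⟩⟩
  | sUnion S _ ih =>
    obtain ⟨U, hUS, hxU⟩ := hx
    obtain ⟨K, hK, hKU⟩ := ih U hUS hxU
    exact ⟨K, hK, fun y hy => ⟨U, hUS, hKU y hy⟩⟩

theorem cOpen_subgroup_iff (hC : IsPseudovariety C) (hCnt : ClassNontrivial C) {F : Type}
    [Group F] {G : Subgroup F} : COpen C (G : Set F) ↔ ∃ K : Subgroup F, IsCoC C K ∧ K ≤ G := by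
  constructor
  · intro h
    obtain ⟨K, hK, hKG⟩ := h.exists_isCoC hC hCnt (one_mem G)
    exact ⟨K, hK, fun y hy => hKG y (by simpa using hy)⟩
  · rintro ⟨K, hK, hKG⟩
    have h : (G : Set F) = ⋃₀ ((fun g => {x : F | g⁻¹ * x ∈ K}) '' (G : Set F)) := by
      ext x
      constructor
      · exact fun hx => ⟨_, ⟨x, hx, rfl⟩, by simp [one_mem]⟩
      · rintro ⟨_, ⟨g, hg, rfl⟩, hx⟩
        simpa using mul_mem hg (hKG hx)
    rw [h]
    refine TopologicalSpace.GenerateOpen.sUnion _ ?_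
    rintro _ ⟨g, -, rfl⟩
    exact TopologicalSpace.GenerateOpen.basic _ ⟨K, hK, g, rfl⟩

end Topology

section Subdirect

variable {C : GrpB → Prop} {F₁ F₂ : Type} [Group F₁] [Group F₂] {G : Subgroup (F₁ × F₂)}

theorem IsSubdirect.exists_mk_left (hG : IsSubdirect G) (a : F₁) : ∃ b, (a, b) ∈ G := by
  obtain ⟨⟨_, b⟩, h, rfl⟩ : a ∈ G.map (MonoidHom.fst F₁ F₂) := hG.1 ▸ trivial
  exact ⟨b, h⟩

theorem IsSubdirect.exists_mk_right (hG : IsSubdirect G) (b : F₂) : ∃ a, (a, b) ∈ G := by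
  obtain ⟨⟨a, _⟩, h, rfl⟩ : b ∈ G.map (MonoidHom.snd F₁ F₂) := hG.2 ▸ trivial
  exact ⟨a, h⟩

theorem IsSubdirect.normal_comap_inl (hG : IsSubdirect G) :
    (G.comap (MonoidHom.inl F₁ F₂)).Normal := by
  refine ⟨fun n hn g => ?_⟩
  obtain ⟨h, hgh⟩ := hG.exists_mk_left g
  have := mul_mem (mul_mem hgh (Subgroup.mem_comap.1 hn)) (inv_mem hgh)
  simpa using this

theorem IsSubdirect.normal_comap_inr (hG : IsSubdirect G) :
    (G.comap (MonoidHom.inr F₁ F₂)).Normal := by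
  refine ⟨fun n hn h => ?_⟩
  obtain ⟨g, hgh⟩ := hG.exists_mk_right h
  have := mul_mem (mul_mem hgh (Subgroup.mem_comap.1 hn)) (inv_mem hgh)
  simpa using this

theorem mem_comap_inr_of_mem_comap_inl {a : F₁} {b : F₂} (h : (a, b) ∈ G)
    (ha : a ∈ G.comap (MonoidHom.inl F₁ F₂)) : b ∈ G.comap (MonoidHom.inr F₁ F₂) := by
  simpa using mul_mem (inv_mem (Subgroup.mem_comap.1 ha)) h

theorem mem_comap_inl_of_mem_comap_inr {a : F₁} {b : F₂} (h : (a, b) ∈ G)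
    (hb : b ∈ G.comap (MonoidHom.inr F₁ F₂)) : a ∈ G.comap (MonoidHom.inl F₁ F₂) := by
  simpa using mul_mem h (inv_mem (Subgroup.mem_comap.1 hb))

theorem IsSubdirect.isCoC_inr (hC : IsPseudovariety C) (hG : IsSubdirect G)
    (h : IsCoC C (G.comap (MonoidHom.inl F₁ F₂))) :
    IsCoC C (G.comap (MonoidHom.inr F₁ F₂)) := by
  obtain ⟨_, h⟩ := h
  have := hG.normal_comap_inr
  refine ⟨this, hC.of_ker_le h
    ((QuotientGroup.mk' (G.comap (MonoidHom.inr F₁ F₂))).comp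
      ((MonoidHom.snd F₁ F₂).comp G.subtype)) ?_
    ((QuotientGroup.mk' _).comp ((MonoidHom.fst F₁ F₂).comp G.subtype)) ?_⟩
  · intro q
    obtain ⟨b, rfl⟩ := QuotientGroup.mk_surjective q
    obtain ⟨a, ha⟩ := hG.exists_mk_right b
    exact ⟨⟨_, ha⟩, rfl⟩
  · rintro ⟨⟨a, b⟩, hab⟩ hker
    exact (QuotientGroup.eq_one_iff b).2
      (mem_comap_inr_of_mem_comap_inl hab ((QuotientGroup.eq_one_iff a).1 hker))

theorem IsSubdirect.isCoC_inl_iff_cOpen (hC : IsPseudovariety C) (hCnt : ClassNontrivial C)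
    (hG : IsSubdirect G) :
    IsCoC C (G.comap (MonoidHom.inl F₁ F₂)) ↔ COpen C (G : Set (F₁ × F₂)) := by
  rw [cOpen_subgroup_iff hC hCnt]
  constructor
  · intro h
    refine ⟨_, IsCoC.inf hC (h.comap hC (MonoidHom.fst F₁ F₂))
      ((hG.isCoC_inr hC h).comap hC (MonoidHom.snd F₁ F₂)), ?_⟩
    rintro ⟨a, b⟩ ⟨ha, hb⟩
    have ha : (a, 1) ∈ G := ha
    have hb : (1, b) ∈ G := hb
    simpa using mul_mem ha hb
  · rintro ⟨K, hK, hKG⟩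
    have := hG.normal_comap_inl
    exact (hK.comap hC (MonoidHom.inl F₁ F₂)).mono hC (Subgroup.comap_mono hKG)

theorem IsSubdirect.conjSepC_of_isCoC (hC : IsPseudovariety C) (hCfin : ClassOfFiniteGroups C)
    (hCnt : ClassNontrivial C) (hCext : IsExtensionClosed C) [IsFreeGroup F₁] [IsFreeGroup F₂]
    (hG : IsSubdirect G) (h₁ : IsCoC C (G.comap (MonoidHom.inl F₁ F₂))) : ConjSepC C G := by
  have h₂ := hG.isCoC_inr hC h₁
  rintro ⟨⟨a, b⟩, hab⟩ ⟨⟨a', b'⟩, hab'⟩ hxy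
  by_cases ha : IsConj a a'
  swap
  · obtain ⟨M, hM, φ, hφ⟩ := conjSepC_of_isFreeGroup hC hCfin hCnt hCext F₁ a a' ha
    exact ⟨M, hM, φ.comp ((MonoidHom.fst F₁ F₂).comp G.subtype), hφ⟩
  by_cases hb : IsConj b b'
  swap
  · obtain ⟨M, hM, φ, hφ⟩ := conjSepC_of_isFreeGroup hC hCfin hCnt hCext F₂ b b' hb
    exact ⟨M, hM, φ.comp ((MonoidHom.snd F₁ F₂).comp G.subtype), hφ⟩
  obtain ⟨g, rfl⟩ := isConj_iff.1 ha
  obtain ⟨h, rfl⟩ := isConj_iff.1 hb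
  obtain ⟨K₁, hK₁, -, hc₁⟩ := exists_isCoC_centralizer hC hCfin hCnt hCext a h₁
  obtain ⟨K₂, hK₂, -, hc₂⟩ := exists_isCoC_centralizer hC hCfin hCnt hCext b h₂
  obtain ⟨hn₁, hK₁⟩ := hK₁
  obtain ⟨hn₂, hK₂⟩ := hK₂
  let φ : G →* (F₁ ⧸ K₁) × (F₂ ⧸ K₂) :=
    ((QuotientGroup.mk' K₁).prodMap (QuotientGroup.mk' K₂)).comp G.subtype
  refine ⟨GrpB.of φ.range, hC.of_injective (hC.prod hK₁ hK₂) φ.range.subtype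
    (Subgroup.subtype_injective _), φ.rangeRestrict, fun hconj => hxy ?_⟩
  obtain ⟨⟨_, ⟨⟨c, d⟩, hcd⟩, rfl⟩, hconj⟩ := isConj_iff.1 hconj
  have hconj := congrArg Subtype.val hconj
  have e₁ : (c : F₁ ⧸ K₁) * a * (c : F₁ ⧸ K₁)⁻¹ = ((g * a * g⁻¹ : F₁) : F₁ ⧸ K₁) :=
    congrArg Prod.fst hconj
  have e₂ : (d : F₂ ⧸ K₂) * b * (d : F₂ ⧸ K₂)⁻¹ = ((h * b * h⁻¹ : F₂) : F₂ ⧸ K₂) :=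
    congrArg Prod.snd hconj
  obtain ⟨z, hz, hzc⟩ := hc₁ (g⁻¹ * c) (by
    rw [← QuotientGroup.eq_one_iff]
    have : ((g⁻¹ * c * a * (g⁻¹ * c)⁻¹ * a⁻¹ : F₁) : F₁ ⧸ K₁) =
        (g : F₁ ⧸ K₁)⁻¹ * ((c : F₁ ⧸ K₁) * a * (c : F₁ ⧸ K₁)⁻¹) * g * (a : F₁ ⧸ K₁)⁻¹ := by
      simp [mul_assoc]
    rw [this, e₁]
    simp [mul_assoc])
  obtain ⟨w, hw, hwd⟩ := hc₂ (h⁻¹ * d) (by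
    rw [← QuotientGroup.eq_one_iff]
    have : ((h⁻¹ * d * b * (h⁻¹ * d)⁻¹ * b⁻¹ : F₂) : F₂ ⧸ K₂) =
        (h : F₂ ⧸ K₂)⁻¹ * ((d : F₂ ⧸ K₂) * b * (d : F₂ ⧸ K₂)⁻¹) * h * (b : F₂ ⧸ K₂)⁻¹ := by
      simp [mul_assoc]
    rw [this, e₂]
    simp [mul_assoc])
  have hmem : (g * z, h * w) ∈ G := by
    have := mul_mem hcd (inv_mem (mul_mem (Subgroup.mem_comap.1 hzc) (Subgroup.mem_comap.1 hwd)))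
    simpa [mul_assoc] using this
  refine isConj_iff.2 ⟨⟨_, hmem⟩, Subtype.ext (Prod.ext ?_ ?_)⟩
  · change g * z * a * (g * z)⁻¹ = g * a * g⁻¹
    rw [mul_assoc g, hz.eq]
    group
  · change h * w * b * (h * w)⁻¹ = h * b * h⁻¹
    rw [mul_assoc h, hw.eq]
    group

theorem IsSubdirect.isCoC_of_conjSepC (hC : IsPseudovariety C)
    (hCnt : ClassNontrivial C) (hF₁ : IsNonAbelianFree F₁) (hF₂ : IsNonAbelianFree F₂)
    (hG : IsSubdirect G) (hfi : G.index ≠ 0) (hsep : ConjSepC C G) :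
    IsCoC C (G.comap (MonoidHom.inl F₁ F₂)) := by
  set N₁ := G.comap (MonoidHom.inl F₁ F₂) with hN₁
  set N₂ := G.comap (MonoidHom.inr F₁ F₂) with hN₂
  have hnorm₁ : N₁.Normal := hG.normal_comap_inl
  have hnorm₂ : N₂.Normal := hG.normal_comap_inr
  have hi₁ : N₁.FiniteIndex := ⟨fun h => hfi (Subgroup.index_eq_zero_of_relIndex_eq_zero (by
    rwa [hN₁, Subgroup.index_comap] at h))⟩
  have hi₂ : N₂.FiniteIndex := ⟨fun h => hfi (Subgroup.index_eq_zero_of_relIndex_eq_zero (by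
    rwa [hN₂, Subgroup.index_comap] at h))⟩
  obtain ⟨n₁, hn₁, hcent₁⟩ := exists_mem_forall_commute_mem hF₁ N₁ hi₁.index_ne_zero
  obtain ⟨n₂, hn₂, hcent₂⟩ := exists_mem_forall_commute_mem hF₂ N₂ hi₂.index_ne_zero
  obtain ⟨T, hT⟩ := Set.Finite.exists_minimal
    (Set.toFinite {T : Subgroup (F₁ ⧸ N₁) | IsCoC C T}) ⟨⊤, IsCoC.top hC hCnt _⟩
  have hTle : ∀ L : Subgroup (F₁ ⧸ N₁), IsCoC C L → T ≤ L := fun L hL =>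
    (hT.2 (hT.1.inf hC hL) inf_le_left).trans inf_le_right
  suffices hbot : T = ⊥ by
    have := hT.1.comap hC (QuotientGroup.mk' N₁)
    rwa [hbot, MonoidHom.comap_bot, QuotientGroup.ker_mk'] at this
  rw [eq_bot_iff]
  intro q hq
  obtain ⟨g, rfl⟩ := QuotientGroup.mk_surjective q
  rw [Subgroup.mem_bot, QuotientGroup.eq_one_iff]
  by_contra hg
  have hx : (n₁, n₂) ∈ G := by
    simpa using mul_mem (Subgroup.mem_comap.1 hn₁) (Subgroup.mem_comap.1 hn₂)
  have hy : (g * n₁ * g⁻¹, n₂) ∈ G := by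
    simpa using mul_mem (Subgroup.mem_comap.1 (hnorm₁.conj_mem n₁ hn₁ g)) (Subgroup.mem_comap.1 hn₂)
  obtain ⟨M, hM, φ, hφ⟩ := hsep ⟨_, hx⟩ ⟨_, hy⟩ (by
    intro h
    obtain ⟨⟨⟨c, d⟩, hcd⟩, h⟩ := isConj_iff.1 h
    have h := congrArg Subtype.val h
    have e₁ : c * n₁ * c⁻¹ = g * n₁ * g⁻¹ := congrArg Prod.fst h
    have e₂ : d * n₂ * d⁻¹ = n₂ := congrArg Prod.snd h
    have hd : d ∈ N₂ := hcent₂ d (mul_inv_eq_iff_eq_mul.1 e₂)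
    have hc : c ∈ N₁ := mem_comap_inl_of_mem_comap_inr hcd hd
    have hgc : c⁻¹ * g ∈ N₁ := hcent₁ _ (by
      calc c⁻¹ * g * n₁ = c⁻¹ * (g * n₁ * g⁻¹) * g := by group
        _ = n₁ * (c⁻¹ * g) := by rw [← e₁]; group)
    exact hg (by simpa using mul_mem hc hgc))
  let ψ : G →* F₁ ⧸ N₁ := (QuotientGroup.mk' N₁).comp ((MonoidHom.fst F₁ F₂).comp G.subtype)
  have hψ : Function.Surjective ψ := by
    intro q
    obtain ⟨a, rfl⟩ := QuotientGroup.mk_surjective q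
    obtain ⟨b, hab⟩ := hG.exists_mk_left a
    exact ⟨⟨_, hab⟩, rfl⟩
  have hL : IsCoC C (φ.ker.map ψ) := by
    have hn : (φ.ker.map ψ).Normal := Subgroup.Normal.map inferInstance ψ hψ
    refine ⟨hn, hC.of_ker_le (Y := M.carrier) hM ((QuotientGroup.mk' (φ.ker.map ψ)).comp ψ)
      ((QuotientGroup.mk'_surjective _).comp hψ) φ fun k hk => ?_⟩
    exact (QuotientGroup.eq_one_iff _).2 ⟨k, hk, rfl⟩
  obtain ⟨⟨⟨k, l⟩, hkl⟩, hker, hk⟩ := hTle _ hL hq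
  have hk : (k : F₁ ⧸ N₁) = g := hk
  have hm : g * k⁻¹ ∈ N₁ := by
    rw [← QuotientGroup.eq_one_iff]
    simp [hk]
  have hm' : (g * k⁻¹, 1) ∈ G := hm
  have hn₁' : (n₁, 1) ∈ G := hn₁
  have hn₂' : (1, n₂) ∈ G := hn₂
  refine hφ (isConj_iff.2 ⟨φ ⟨_, hm'⟩, ?_⟩)
  have e₁ : (⟨(n₁, n₂), hx⟩ : G) = ⟨_, hn₁'⟩ * ⟨_, hn₂'⟩ := Subtype.ext (by simp)
  have e₂ : (⟨(g * n₁ * g⁻¹, n₂), hy⟩ : G) =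
      ⟨_, hm'⟩ * (⟨_, hkl⟩ * ⟨_, hn₁'⟩ * ⟨_, hkl⟩⁻¹ * ⟨_, hn₂'⟩) * ⟨_, hm'⟩⁻¹ :=
    Subtype.ext (by simp [mul_assoc])
  have hker : φ ⟨_, hkl⟩ = 1 := hker
  rw [e₁, e₂]
  simp only [map_mul, map_inv, hker, one_mul, inv_one, mul_one]

end Subdirect

/-- Corollary 1.2: characterization of `C`-conjugacy separable
subdirect products of finite index in a product of two non-abelian free groups. -/
theorem stmt1 (C : GrpB → Prop) (hC : IsPseudovariety C)
    (hCfin : ClassOfFiniteGroups C) (hCnt : ClassNontrivial C)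
    (hCext : IsExtensionClosed C)
    (F₁ F₂ : Type) [Group F₁] [Group F₂]
    (hF₁ : IsNonAbelianFree F₁) (hF₂ : IsNonAbelianFree F₂)
    (G : Subgroup (F₁ × F₂)) (hG : IsSubdirect G) (hfi : G.index ≠ 0)
    (N₁ : Subgroup F₁) (hN₁ : N₁ = Subgroup.comap (MonoidHom.inl F₁ F₂) G) [N₁.Normal] :
    (ConjSepC C ↥G ↔ C (GrpB.of (F₁ ⧸ N₁))) ∧
    (C (GrpB.of (F₁ ⧸ N₁)) ↔ COpen C (G : Set (F₁ × F₂))) := by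
  have := hF₁.isFreeGroup
  have := hF₂.isFreeGroup
  have hN : C (GrpB.of (F₁ ⧸ N₁)) ↔ IsCoC C (G.comap (MonoidHom.inl F₁ F₂)) := by
    subst hN₁
    exact ⟨fun h => ⟨_, h⟩, fun ⟨_, h⟩ => h⟩
  rw [hN]
  exact ⟨⟨hG.isCoC_of_conjSepC hC hCnt hF₁ hF₂ hfi,
    hG.conjSepC_of_isCoC hC hCfin hCnt hCext⟩, hG.isCoC_inl_iff_cOpen hC hCnt⟩
end

section
/- If a group G possesses a subgroup of finite index that is not conjugacy separable, then there exist a group K and an injective homomorphism ι : G → K such that ι(G) has finite index in K and K is not conjugacy separable. -/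
/-- The permutational wreath product of the group of order two with `G`, acting on `G ⧸ H`. -/
abbrev CosetLamplighter {G : Type} [Group G] (H : Subgroup G) : Type :=
  (G ⧸ H → Multiplicative (ZMod 2)) ⋊[mulAutArrow] G

namespace CosetLamplighter

variable {G : Type} [Group G] {H : Subgroup G}

open Classical in
/-- The configuration in which only the lamp at the trivial coset is lit. -/
noncomputable def lamp (H : Subgroup G) : G ⧸ H → Multiplicative (ZMod 2) :=
  Pi.mulSingle ((1 : G) : G ⧸ H) (Multiplicative.ofAdd 1)

open Classical in
lemma lamp_one_coset : lamp H ((1 : G) : G ⧸ H) = Multiplicative.ofAdd 1 :=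
  Pi.mulSingle_eq_same ..

open Classical in
lemma lamp_of_ne {c : G ⧸ H} (hc : c ≠ ((1 : G) : G ⧸ H)) : lamp H c = 1 :=
  Pi.mulSingle_eq_of_ne hc _

lemma mulAutArrow_apply_coset (g : G) (f : G ⧸ H → Multiplicative (ZMod 2)) (c : G ⧸ H) :
    (mulAutArrow g : MulAut (G ⧸ H → Multiplicative (ZMod 2))) f c = f (g⁻¹ • c) := rfl

lemma smul_one_coset {g : G} : g • ((1 : G) : G ⧸ H) = ((1 : G) : G ⧸ H) ↔ g ∈ H := by
  rw [MulAction.Quotient.smul_coe, smul_eq_mul, mul_one, eq_comm, QuotientGroup.eq]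
  simp

lemma mulAutArrow_lamp {h : G} (hh : h ∈ H) :
    (mulAutArrow h : MulAut (G ⧸ H → Multiplicative (ZMod 2))) (lamp H) = lamp H := by
  funext c
  rw [mulAutArrow_apply_coset]
  have key : h⁻¹ • c = ((1 : G) : G ⧸ H) ↔ c = ((1 : G) : G ⧸ H) := by
    rw [inv_smul_eq_iff, smul_one_coset.2 hh]
  by_cases hc : c = ((1 : G) : G ⧸ H)
  · rw [key.2 hc, hc]
  · rw [lamp_of_ne (mt key.1 hc), lamp_of_ne hc]

lemma mem_of_lamp_conj {x y g : G} (hy : y ∈ H) {b : G ⧸ H → Multiplicative (ZMod 2)}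
    (hc : (⟨b, g⟩ : CosetLamplighter H) * ⟨lamp H, x⟩ = ⟨lamp H, y⟩ * ⟨b, g⟩) : g ∈ H := by
  have hl := congrFun (congrArg SemidirectProduct.left hc) ((1 : G) : G ⧸ H)
  simp only [SemidirectProduct.mul_left, Pi.mul_apply, mulAutArrow_apply_coset,
    smul_one_coset.2 (H.inv_mem hy)] at hl
  rw [mul_comm] at hl
  have hl := mul_right_cancel hl
  by_contra hg
  have hg' : g⁻¹ • ((1 : G) : G ⧸ H) ≠ ((1 : G) : G ⧸ H) := by
    rwa [Ne, smul_one_coset, H.inv_mem_iff]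
  rw [lamp_one_coset, lamp_of_ne hg'] at hl
  exact absurd hl (by decide)

lemma isConj_of_isConj_lamp {x y : H}
    (hc : IsConj (⟨lamp H, x⟩ : CosetLamplighter H) ⟨lamp H, y⟩) : IsConj x y := by
  obtain ⟨⟨b, g⟩, hk⟩ := isConj_iff.1 hc
  rw [mul_inv_eq_iff_eq_mul] at hk
  have hr := congrArg SemidirectProduct.right hk
  refine isConj_iff.2 ⟨⟨g, mem_of_lamp_conj y.2 hk⟩, Subtype.ext ?_⟩
  exact mul_inv_eq_iff_eq_mul.2 hr

lemma isConj_map_lamp {M : Type} [Group M] (φ : CosetLamplighter H →* M) {x y h : H}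
    (hφ : φ (SemidirectProduct.inr (h * x * h⁻¹ : G)) = φ (SemidirectProduct.inr (y : G))) :
    IsConj (φ ⟨lamp H, x⟩) (φ ⟨lamp H, y⟩) := by
  have hcomm : (SemidirectProduct.inr (h : G) : CosetLamplighter H) *
      SemidirectProduct.inl (lamp H) =
      SemidirectProduct.inl (lamp H) * SemidirectProduct.inr (h : G) := by
    ext1 <;> simp [mulAutArrow_lamp h.2]
  have hsplit (z : G) : (⟨lamp H, z⟩ : CosetLamplighter H) =
      SemidirectProduct.inl (lamp H) * SemidirectProduct.inr z :=
    SemidirectProduct.mk_eq_inl_mul_inr ..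
  refine isConj_iff.2 ⟨φ (SemidirectProduct.inr (h : G)), ?_⟩
  rw [hsplit, hsplit, map_mul φ _ (SemidirectProduct.inr (y : G)), ← hφ, ← map_inv, ← map_mul,
    ← map_mul, ← map_mul, ← mul_assoc, hcomm]
  simp [mul_assoc]

lemma index_range_inr_ne_zero (hfi : H.index ≠ 0) :
    (SemidirectProduct.inr : G →* CosetLamplighter H).range.index ≠ 0 := by
  have : H.FiniteIndex := ⟨hfi⟩
  have : Finite (CosetLamplighter H ⧸ (SemidirectProduct.inr : G →* CosetLamplighter H).range) := by
    refine Finite.of_surjective (fun a : G ⧸ H → Multiplicative (ZMod 2) ↦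
      ((SemidirectProduct.inl a : CosetLamplighter H) : CosetLamplighter H ⧸ _)) fun q ↦ ?_
    induction q using QuotientGroup.induction_on with
    | H k =>
      refine ⟨k.left, QuotientGroup.eq.2 ⟨k.right, ?_⟩⟩
      rw [eq_inv_mul_iff_mul_eq, SemidirectProduct.inl_left_mul_inr_right]
  exact Subgroup.index_ne_zero_of_finite

end CosetLamplighter

/-- Corollary 1.4: a group with a non-conjugacy separable
subgroup of finite index has a finite-index overgroup which is not conjugacy
separable. -/
theorem stmt3 (G : Type) [Group G] (H : Subgroup G) (hfi : H.index ≠ 0)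
    (hH : ¬ ConjSepC CFin ↥H) :
    ∃ K : GrpB, ∃ ι : G →* K.carrier,
      Function.Injective ι ∧ ι.range.index ≠ 0 ∧ ¬ ConjSepC CFin K.carrier := by
  refine ⟨GrpB.of (CosetLamplighter H), SemidirectProduct.inr, SemidirectProduct.inr_injective,
    CosetLamplighter.index_range_inr_ne_zero hfi, fun hK ↦ hH fun x y hxy ↦ ?_⟩
  obtain ⟨M, hM, φ, hφ⟩ := hK ⟨CosetLamplighter.lamp H, x⟩ ⟨CosetLamplighter.lamp H, y⟩
    (hxy ∘ CosetLamplighter.isConj_of_isConj_lamp)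
  let ψ : H →* M.carrier :=
    (show CosetLamplighter H →* M.carrier from φ).comp (SemidirectProduct.inr.comp H.subtype)
  have : Finite M.carrier := hM
  refine ⟨GrpB.of ψ.range, (inferInstance : Finite ψ.range), ψ.rangeRestrict, fun hc ↦ hφ ?_⟩
  obtain ⟨⟨_, h, rfl⟩, hh⟩ := isConj_iff.1 hc
  refine CosetLamplighter.isConj_map_lamp (h := h) φ ?_
  have hh' := congrArg Subtype.val hh
  change ψ h * ψ x * (ψ h)⁻¹ = ψ y at hh'
  rwa [← map_inv, ← map_mul, ← map_mul] at hh'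
end
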